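/- arXiv:1702.07632 — 13 statements merged into one kernel-verified Lean document; each statement's English description precedes it below -/
import Mathlib

section
/- Let m, m' be natural numbers, t : Fin m → ℂ, t' : Fin m' → ℂ, and let F : ℂ → ℂ be a continuous function with F(s) ≠ 0 for every s ∈ ℂ. If F(s)·∏_{i : Fin m} Γ(s + t i) = ∏_{j : Fin m'} Γ(s + t' j) for all s ∈ ℂ, then m = m', the multiset {t i : i ∈ Fin m} equals the multiset {t' j : j ∈ Fin m'} (as elements of Multiset ℂ), and F(s) = 1 for all s ∈ ℂ. -/
open Complex

open Filter Topology

lemma tendsto_add_punctured (a w : ℂ) :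
    Tendsto (fun s : ℂ => s + w) (𝓝[≠] a) (𝓝[≠] (a + w)) := by
  refine tendsto_nhdsWithin_iff.2 ⟨?_, ?_⟩
  · exact ((continuous_id.add continuous_const).tendsto a).mono_left nhdsWithin_le_nhds
  · filter_upwards [self_mem_nhdsWithin] with s hs
    simpa using hs

/-- The Gamma function has a simple pole at each nonpositive integer. -/
lemma exists_tendsto_mul_Gamma_neg_nat (n : ℕ) :
    ∃ c : ℂ, c ≠ 0 ∧ Tendsto (fun z : ℂ => (z - -n) * Gamma z) (𝓝[≠] (-n)) (𝓝 c) := by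
  induction n with
  | zero => exact ⟨1, one_ne_zero, by simpa using tendsto_self_mul_Gamma_nhds_zero⟩
  | succ n ih =>
    obtain ⟨c, hc, hlim⟩ := ih
    have hne : (-((n + 1 : ℕ) : ℂ)) ≠ 0 := neg_ne_zero.2 (Nat.cast_ne_zero.2 n.succ_ne_zero)
    have hshift := tendsto_add_punctured (-((n + 1 : ℕ) : ℂ)) 1
    rw [show -((n + 1 : ℕ) : ℂ) + 1 = -n by push_cast; ring] at hshift
    have hid : Tendsto (fun z : ℂ => z) (𝓝[≠] (-((n + 1 : ℕ) : ℂ)))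
        (𝓝 (-((n + 1 : ℕ) : ℂ))) := tendsto_id.mono_left nhdsWithin_le_nhds
    refine ⟨c / (-((n + 1 : ℕ) : ℂ)), div_ne_zero hc hne,
      ((hlim.comp hshift).div hid hne).congr' ?_⟩
    filter_upwards [hid.eventually_ne hne] with z hz
    change (z + 1 - -(n : ℂ)) * Gamma (z + 1) / z = _
    rw [Gamma_add_one z hz]
    push_cast
    field_simp
    ring

open Classical in
/-- Number of factors of `s ↦ ∏ i, Γ (s + t i)` having a pole at `a`. -/
noncomputable def poleCount {m : ℕ} (t : Fin m → ℂ) (a : ℂ) : ℕ :=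
  ∑ i, if ∃ n : ℕ, a + t i = -n then 1 else 0

lemma exists_tendsto_pow_mul_prod_Gamma {m : ℕ} (t : Fin m → ℂ) (a : ℂ) :
    ∃ c : ℂ, c ≠ 0 ∧ Tendsto (fun s : ℂ => (s - a) ^ poleCount t a * ∏ i, Gamma (s + t i))
      (𝓝[≠] a) (𝓝 c) := by
  classical
  have hfactor : ∀ i, ∃ c : ℂ, c ≠ 0 ∧ Tendsto (fun s : ℂ =>
      (s - a) ^ (if ∃ n : ℕ, a + t i = -n then 1 else 0) * Gamma (s + t i))
      (𝓝[≠] a) (𝓝 c) := by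
    intro i
    have hshift := tendsto_add_punctured a (t i)
    split_ifs with hp
    · obtain ⟨n, hn⟩ := hp
      obtain ⟨c, hc, hlim⟩ := exists_tendsto_mul_Gamma_neg_nat n
      rw [← hn] at hlim
      refine ⟨c, hc, (hlim.comp hshift).congr fun s => ?_⟩
      simp
    · push Not at hp
      refine ⟨_, Gamma_ne_zero hp, ?_⟩
      simpa [Function.comp_def] using (continuousAt_Gamma _ hp).tendsto.comp (hshift.mono_right nhdsWithin_le_nhds)
  choose c hc hlim using hfactor
  refine ⟨∏ i, c i, Finset.prod_ne_zero_iff.2 fun i _ => hc i,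
    (tendsto_finsetProd Finset.univ fun i _ => hlim i).congr fun s => ?_⟩
  rw [Finset.prod_mul_distrib, Finset.prod_pow_eq_pow_sum, poleCount]

lemma poleCount_le {m m' : ℕ} {t : Fin m → ℂ} {t' : Fin m' → ℂ} {F : ℂ → ℂ}
    (hF : Continuous F)
    (h : ∀ s : ℂ, F s * ∏ i, Gamma (s + t i) = ∏ j, Gamma (s + t' j)) (a : ℂ) :
    poleCount t' a ≤ poleCount t a := by
  by_contra! hlt
  obtain ⟨c, -, hlim⟩ := exists_tendsto_pow_mul_prod_Gamma t a
  obtain ⟨c', hc', hlim'⟩ := exists_tendsto_pow_mul_prod_Gamma t' a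
  have hpow : Tendsto (fun s : ℂ => (s - a) ^ (poleCount t' a - poleCount t a))
      (𝓝[≠] a) (𝓝 0) := by
    have : Continuous fun s : ℂ => (s - a) ^ (poleCount t' a - poleCount t a) := by fun_prop
    simpa [Nat.sub_ne_zero_of_lt hlt] using (this.tendsto a).mono_left nhdsWithin_le_nhds
  have hzero := (hpow.mul ((hF.tendsto a).mono_left nhdsWithin_le_nhds)).mul hlim
  rw [zero_mul, zero_mul] at hzero
  refine hc' (tendsto_nhds_unique hlim' (hzero.congr fun s => ?_))
  rw [← h s, ← Nat.sub_add_cancel hlt.le, pow_add, Nat.add_sub_cancel]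
  ring

/-- The multiplicity of a shift is recovered from the pole counts. -/
lemma poleCount_neg_eq {m : ℕ} (t : Fin m → ℂ) (a : ℂ) :
    poleCount t (-a) = (Finset.univ.val.map t).count a + poleCount t (1 - a) := by
  classical
  rw [Multiset.count_map, ← Finset.filter_val, Finset.card_val, Finset.card_filter,
    poleCount, poleCount, ← Finset.sum_add_distrib]
  refine Finset.sum_congr rfl fun i _ => ?_
  by_cases hi : a = t i
  · have h0 : ∃ n : ℕ, -a + t i = -n := ⟨0, by simp [hi]⟩
    have h1 : ¬ ∃ n : ℕ, 1 - a + t i = -n := by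
      rintro ⟨n, hn⟩
      have : ((n + 1 : ℕ) : ℂ) = 0 := by
        push_cast
        linear_combination hn + hi
      exact n.succ_ne_zero (Nat.cast_eq_zero.1 this)
    rw [if_pos h0, if_pos hi, if_neg h1]
  · have hiff : (∃ n : ℕ, -a + t i = -n) ↔ ∃ n : ℕ, 1 - a + t i = -n := by
      constructor
      · rintro ⟨_ | n, hn⟩
        · refine absurd ?_ hi
          simp only [Nat.cast_zero] at hn
          linear_combination -hn
        · refine ⟨n, ?_⟩
          push_cast at hn
          linear_combination hn
      · rintro ⟨n, hn⟩
        refine ⟨n + 1, ?_⟩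
        push_cast
        linear_combination hn
    simp only [hiff, if_neg hi, zero_add]

lemma dense_prod_Gamma_ne_zero {m : ℕ} (t : Fin m → ℂ) :
    Dense {s : ℂ | ∏ i, Gamma (s + t i) ≠ 0} := by
  have hcount : (Set.range fun p : Fin m × ℕ => -(p.2 : ℂ) - t p.1).Countable :=
    Set.countable_range _
  refine (hcount.dense_compl ℝ).mono fun s hs => Finset.prod_ne_zero_iff.2 fun i _ => ?_
  refine Gamma_ne_zero fun n hn => hs ⟨(i, n), ?_⟩
  linear_combination -hn

theorem gamma_product_lemma (m m' : ℕ) (t : Fin m → ℂ) (t' : Fin m' → ℂ)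
    (F : ℂ → ℂ) (hF : Continuous F) (hFne : ∀ s : ℂ, F s ≠ 0)
    (h : ∀ s : ℂ, F s * ∏ i : Fin m, Complex.Gamma (s + t i)
      = ∏ j : Fin m', Complex.Gamma (s + t' j)) :
    m = m' ∧ Finset.univ.val.map t = Finset.univ.val.map t' ∧ ∀ s : ℂ, F s = 1 := by
  have hcount : ∀ a, poleCount t a = poleCount t' a := fun a =>
    le_antisymm
      (poleCount_le (hF.inv₀ hFne) (fun s => by rw [← h s, Pi.inv_apply, inv_mul_cancel_left₀ (hFne s)]) a)
      (poleCount_le hF h a)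
  have hmulti : Finset.univ.val.map t = Finset.univ.val.map t' := by
    classical
    ext a
    have h1 := poleCount_neg_eq t a
    have h2 := poleCount_neg_eq t' a
    rw [hcount, hcount] at h1
    convert Nat.add_right_cancel (h1.symm.trans h2)
  refine ⟨by simpa using congrArg Multiset.card hmulti, hmulti, ?_⟩
  have hprod : ∀ s : ℂ, ∏ i, Gamma (s + t i) = ∏ j, Gamma (s + t' j) := fun s => by
    simpa [Multiset.map_map, Function.comp_def, Finset.prod] using
      congrArg (fun M => (M.map fun z => Gamma (s + z)).prod) hmulti
  refine congrFun (hF.ext_on (dense_prod_Gamma_ne_zero t) continuous_const fun s hs => ?_)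
  exact mul_right_cancel₀ hs (by rw [h s, one_mul, hprod s])
end

section
/- (Step 1 of the complex case.) Let n ∈ ℕ, N, N' : Fin n → ℤ, t, t' : Fin n → ℂ, and let M ∈ ℤ satisfy N i + M > 0 and N' i + M > 0 for all i ∈ Fin n. If for every s ∈ ℂ one has ∏_{i : Fin n} 2·(2π)^{−(t i + s)}·Γ(t i + s) = ∏_{i : Fin n} 2·(2π)^{−(t' i + s)}·Γ(t' i + s), then the multiset {t i : i ∈ Fin n} equals the multiset {t' i : i ∈ Fin n} in Multiset ℂ. -/
open Complex

/-- The shift `s ↦ s + 1` multiplies a product of complex `L`-factors by a polynomial in `s`. -/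
lemma prod_Gamma_factor_add_one {n : ℕ} (t : Fin n → ℂ) (s : ℂ) (hs : ∀ i, t i + s ≠ 0) :
    ∏ i : Fin n, 2 * (2 * (Real.pi : ℂ)) ^ (-(t i + (s + 1))) * Complex.Gamma (t i + (s + 1))
      = (∏ i : Fin n, 2 * (2 * (Real.pi : ℂ)) ^ (-(t i + s)) * Complex.Gamma (t i + s)) *
        ((∏ i : Fin n, (t i + s)) * ((2 * (Real.pi : ℂ))⁻¹) ^ n) := by
  have hpi : (2 * (Real.pi : ℂ)) ≠ 0 := by simp [Real.pi_ne_zero]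
  have hconst : ((2 * (Real.pi : ℂ))⁻¹) ^ n = ∏ _i : Fin n, (2 * (Real.pi : ℂ))⁻¹ := by simp
  rw [hconst, ← Finset.prod_mul_distrib, ← Finset.prod_mul_distrib]
  refine Finset.prod_congr rfl fun i _ ↦ ?_
  rw [← add_assoc, Complex.Gamma_add_one _ (hs i), neg_add, Complex.cpow_add _ _ hpi,
    Complex.cpow_neg_one]
  ring

lemma prod_Gamma_factor_ne_zero {n : ℕ} (t : Fin n → ℂ) (s : ℂ) (hs : ∀ i, 0 < (t i + s).re) :
    ∏ i : Fin n, 2 * (2 * (Real.pi : ℂ)) ^ (-(t i + s)) * Complex.Gamma (t i + s) ≠ 0 := by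
  refine Finset.prod_ne_zero_iff.mpr fun i _ ↦ mul_ne_zero (mul_ne_zero two_ne_zero ?_)
    (Complex.Gamma_ne_zero_of_re_pos (hs i))
  simp [Complex.cpow_eq_zero_iff, Real.pi_ne_zero]

/-- A finite family is determined up to order by the values of `∏ i, (t i + k)` at large
natural numbers `k`. -/
lemma map_univ_eq_of_eventually_prod_add_eq {n : ℕ} (t t' : Fin n → ℂ)
    (h : ∀ᶠ k : ℕ in Filter.atTop, ∏ i, (t i + (k : ℂ)) = ∏ i, (t' i + (k : ℂ))) :
    Finset.univ.val.map t = Finset.univ.val.map t' := by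
  have hpoly : ∏ i, (Polynomial.X - Polynomial.C (-t i)) =
      ∏ i, (Polynomial.X - Polynomial.C (-t' i)) := by
    refine Polynomial.eq_of_infinite_eval_eq _ _ ?_
    obtain ⟨K, hK⟩ := Filter.eventually_atTop.mp h
    refine ((Set.Ici_infinite K).image (Nat.cast_injective (R := ℂ)).injOn).mono ?_
    rintro _ ⟨k, hk, rfl⟩
    simpa [Polynomial.eval_prod, add_comm] using hK k hk
  have hroots (u : Fin n → ℂ) : (∏ i, (Polynomial.X - Polynomial.C (-u i))).roots =
      (Finset.univ.val.map u).map Neg.neg := by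
    rw [← Polynomial.roots_multiset_prod_X_sub_C ((Finset.univ.val.map u).map Neg.neg)]
    simp only [Multiset.map_map]
    rfl
  apply Multiset.map_injective (neg_injective (G := ℂ))
  rw [← hroots, ← hroots, hpoly]

theorem complex_case_step1 (n : ℕ) (N N' : Fin n → ℤ) (t t' : Fin n → ℂ) (M : ℤ)
    (hM : ∀ i : Fin n, 0 < N i + M) (hM' : ∀ i : Fin n, 0 < N' i + M)
    (h : ∀ s : ℂ,
      ∏ i : Fin n, 2 * (2 * (Real.pi : ℂ)) ^ (-(t i + s)) * Complex.Gamma (t i + s)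
      = ∏ i : Fin n, 2 * (2 * (Real.pi : ℂ)) ^ (-(t' i + s)) * Complex.Gamma (t' i + s)) :
    Finset.univ.val.map t = Finset.univ.val.map t' := by
  have hpos (u : Fin n → ℂ) : ∀ᶠ k : ℕ in Filter.atTop, ∀ i, 0 < (u i + (k : ℂ)).re := by
    refine Filter.eventually_all.mpr fun i ↦ ?_
    filter_upwards [tendsto_natCast_atTop_atTop.eventually_gt_atTop (-(u i).re)] with k hk
    simp only [add_re, natCast_re]
    linarith
  refine map_univ_eq_of_eventually_prod_add_eq t t' ?_
  filter_upwards [hpos t, hpos t'] with k hk hk'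
  have hne {z : ℂ} (hz : 0 < z.re) : z ≠ 0 := by
    rintro rfl
    simp at hz
  have hshift := h (k + 1)
  rw [prod_Gamma_factor_add_one t k fun i ↦ hne (hk i),
    prod_Gamma_factor_add_one t' k fun i ↦ hne (hk' i), ← h k] at hshift
  exact mul_right_cancel₀ (pow_ne_zero n (by simp [Real.pi_ne_zero]))
    (mul_left_cancel₀ (prod_Gamma_factor_ne_zero t k hk) hshift)
end

section
/- (Step 2 of the complex case.) Let n ∈ ℕ with n ≥ 1, N, N' : Fin n → ℤ and t, t' : Fin n → ℂ. For K ∈ ℤ and w ∈ ℂ set L(K, w) := 2·(2π)^{−(w + max(−K,0))}·Γ(w + max(−K,0)), where max(−K,0) ∈ ℕ is coerced to ℂ. Assume that for every M ∈ ℤ and every s ∈ ℂ one has ∏_{i : Fin n} L(N i + M, t i + s) = ∏_{i : Fin n} L(N' i + M, t' i + s). Then min_{i ∈ Fin n} N i = min_{i ∈ Fin n} N' i. -/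
open Complex

/-- The local `L`-factor of the character `χ_{-K, w}` of `ℂ^×`:
`L(χ_{-K,w}) = 2 (2π)^{-(w + max(-K,0))} Γ(w + max(-K,0))`. -/
noncomputable def Lfac (K : ℤ) (w : ℂ) : ℂ :=
  2 * (2 * (Real.pi : ℂ)) ^ (-(w + ((-K).toNat : ℂ))) * Complex.Gamma (w + ((-K).toNat : ℂ))

lemma Lfac_eq_Gammaℂ (K : ℤ) (w : ℂ) : Lfac K w = Gammaℂ (w + ((-K).toNat : ℂ)) := rfl

lemma norm_Gammaℂ_pos {w : ℂ} (hw : 0 < w.re) : 0 < ‖Gammaℂ w‖ := by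
  have hpi : (2 * (Real.pi : ℂ)) ≠ 0 := by exact_mod_cast Real.two_pi_pos.ne'
  rw [norm_pos_iff, Gammaℂ_def]
  exact mul_ne_zero (mul_ne_zero two_ne_zero (by simp [cpow_eq_zero_iff, hpi]))
    (Gamma_ne_zero_of_re_pos hw)

lemma norm_Gammaℂ_lt_add_one {w : ℂ} (hw : 2 * Real.pi < w.re) :
    ‖Gammaℂ w‖ < ‖Gammaℂ (w + 1)‖ := by
  have hpi := Real.two_pi_pos
  have hre : 0 < w.re := hpi.trans hw
  have h0 : w ≠ 0 := by rintro rfl; simp at hre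
  have hG := norm_Gammaℂ_pos hre
  have hnorm : ‖w / 2 / (Real.pi : ℂ)‖ = ‖w‖ / (2 * Real.pi) := by
    rw [div_div, norm_div]
    congr 1
    simp [abs_of_pos Real.pi_pos]
  have hlt : 1 < ‖w‖ / (2 * Real.pi) := by
    rw [one_lt_div hpi]
    exact hw.trans_le (re_le_norm w)
  rw [Gammaℂ_add_one h0, mul_div_assoc, mul_div_assoc, norm_mul, hnorm]
  exact lt_mul_of_one_lt_right hG hlt

lemma strictMono_norm_Gammaℂ_add_natCast {w : ℂ} (hw : 2 * Real.pi < w.re) :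
    StrictMono fun k : ℕ => ‖Gammaℂ (w + k)‖ := by
  refine strictMono_nat_of_lt_succ fun k => ?_
  have hk : 2 * Real.pi < (w + k).re := by
    simpa using hw.trans_le (le_add_of_nonneg_right k.cast_nonneg)
  simpa [add_assoc] using norm_Gammaℂ_lt_add_one hk

/-- A lower bound for the parameters on one side is a lower bound for those on the other. -/
lemma le_of_forall_prod_Lfac_eq {ι κ : Type*} [Fintype ι] [Fintype κ] {N : ι → ℤ} {N' : κ → ℤ}
    {t : ι → ℂ} {t' : κ → ℂ}
    (h : ∀ M : ℤ, ∀ s : ℂ, ∏ i, Lfac (N i + M) (t i + s) = ∏ i, Lfac (N' i + M) (t' i + s))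
    {c : ℤ} (hc : ∀ i, c ≤ N' i) (j : ι) : c ≤ N j := by
  by_contra! hj
  set M : ℤ := |c| + ∑ i, |N i| with hM
  set x : ℝ := 2 * Real.pi + 1 + ∑ i, ‖t i‖ with hx
  have hMc : -c ≤ M := by
    have : 0 ≤ ∑ i, |N i| := Finset.sum_nonneg fun i _ => abs_nonneg _
    have := neg_abs_le c
    linarith
  have hMN (i : ι) : 0 ≤ N i + M := by
    have := Finset.single_le_sum (f := fun i => |N i|) (fun i _ => abs_nonneg _)
      (Finset.mem_univ i)
    have := neg_abs_le (N i)
    have := abs_nonneg c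
    linarith
  have hre (i : ι) : 2 * Real.pi < (t i + x).re := by
    have := Finset.single_le_sum (f := fun i => ‖t i‖) (fun i _ => norm_nonneg _)
      (Finset.mem_univ i)
    have := neg_le_of_abs_le (abs_re_le_norm (t i))
    rw [add_re, ofReal_re]
    linarith
  have hright : ∏ i, Lfac (N' i + -c) (t' i + x) = ∏ i, Lfac (N' i + M) (t' i + x) := by
    refine Finset.prod_congr rfl fun i _ => ?_
    have := hc i
    rw [Lfac_eq_Gammaℂ, Lfac_eq_Gammaℂ, Int.toNat_of_nonpos (by linarith),
      Int.toNat_of_nonpos (by linarith)]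
  have hleft : ∏ i, Lfac (N i + -c) (t i + x) = ∏ i, Lfac (N i + M) (t i + x) := by
    rw [h, h, hright]
  refine absurd (congrArg norm hleft) (ne_of_gt ?_)
  rw [norm_prod, norm_prod]
  have hzero (i : ι) : (-(N i + M)).toNat = 0 :=
    Int.toNat_of_nonpos (neg_nonpos.mpr (hMN i))
  simp only [Lfac_eq_Gammaℂ, hzero]
  refine Finset.prod_lt_prod (fun i _ => ?_) (fun i _ => ?_) ⟨j, Finset.mem_univ j, ?_⟩
  · simpa using norm_Gammaℂ_pos (Real.two_pi_pos.trans (hre i))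
  · exact (strictMono_norm_Gammaℂ_add_natCast (hre i)).monotone (Nat.zero_le _)
  · exact strictMono_norm_Gammaℂ_add_natCast (hre j) (by omega)

theorem complex_case_step2 (n : ℕ) (hn : 1 ≤ n) (N N' : Fin n → ℤ) (t t' : Fin n → ℂ)
    (h : ∀ M : ℤ, ∀ s : ℂ,
      ∏ i : Fin n, Lfac (N i + M) (t i + s) = ∏ i : Fin n, Lfac (N' i + M) (t' i + s)) :
    Finset.univ.inf' (Finset.univ_nonempty_iff.mpr (Fin.pos_iff_nonempty.mp hn)) N
      = Finset.univ.inf' (Finset.univ_nonempty_iff.mpr (Fin.pos_iff_nonempty.mp hn)) N' := by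
  refine le_antisymm (Finset.le_inf' _ _ fun j _ => ?_) (Finset.le_inf' _ _ fun j _ => ?_)
  · exact le_of_forall_prod_Lfac_eq (fun M s => (h M s).symm)
      (fun i => Finset.inf'_le _ (Finset.mem_univ i)) j
  · exact le_of_forall_prod_Lfac_eq h (fun i => Finset.inf'_le _ (Finset.mem_univ i)) j
end

section
/- (Step 3 of the complex case: existence of a common constituent.) Let n ∈ ℕ with n ≥ 1, N, N' : Fin n → ℤ and t, t' : Fin n → ℂ. For K ∈ ℤ and w ∈ ℂ set L(K, w) := 2·(2π)^{−(w + max(−K,0))}·Γ(w + max(−K,0)), where max(−K,0) ∈ ℕ is coerced to ℂ. Assume that for every M ∈ ℤ and every s ∈ ℂ one has ∏_{i : Fin n} L(N i + M, t i + s) = ∏_{i : Fin n} L(N' i + M, t' i + s). Then there exist indices i, j ∈ Fin n with N i = N' j and t i = t' j. -/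
open Complex

theorem Lfac_eq_zero_iff (K : ℤ) (w : ℂ) :
    Lfac K w = 0 ↔ ∃ m : ℕ, w + ((-K).toNat : ℂ) = -m := by
  have hpi : (2 * (Real.pi : ℂ)) ≠ 0 := by simp [Real.pi_ne_zero]
  simp [Lfac, cpow_eq_zero_iff, hpi, Gamma_eq_zero_iff]

/-- If two products of twisted `L`-factors agree, then every parameter `(N i, t i)` on one side
lies above some parameter on the other side, for the partial order in which `(A, a) ≤ (B, b)`
means that `b - a` and `(b - B) - (a - A)` are natural numbers. -/
theorem exists_le_of_prod_Lfac_eq {ι κ : Type*} [Fintype ι] [Fintype κ]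
    {N : ι → ℤ} {t : ι → ℂ} {N' : κ → ℤ} {t' : κ → ℂ}
    (h : ∀ M : ℤ, ∀ s : ℂ, ∏ i, Lfac (N i + M) (t i + s) = ∏ j, Lfac (N' j + M) (t' j + s))
    (i : ι) : ∃ (j : κ) (k : ℕ), t i = t' j + k ∧ N i ≤ N' j + k := by
  have hzero : ∏ j, Lfac (N' j + -N i) (t' j + -t i) = 0 := by
    rw [← h]
    exact Finset.prod_eq_zero (Finset.mem_univ i) ((Lfac_eq_zero_iff _ _).2 ⟨0, by simp⟩)
  obtain ⟨j, -, hj⟩ := Finset.prod_eq_zero_iff.1 hzero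
  obtain ⟨m, hm⟩ := (Lfac_eq_zero_iff _ _).1 hj
  refine ⟨j, m + (-(N' j + -N i)).toNat, ?_, by omega⟩
  push_cast
  linear_combination -hm

theorem complex_case_step3 (n : ℕ) (hn : 1 ≤ n) (N N' : Fin n → ℤ) (t t' : Fin n → ℂ)
    (h : ∀ M : ℤ, ∀ s : ℂ,
      ∏ i : Fin n, Lfac (N i + M) (t i + s) = ∏ i : Fin n, Lfac (N' i + M) (t' i + s)) :
    ∃ i j : Fin n, N i = N' j ∧ t i = t' j := by
  have : Nonempty (Fin n) := ⟨⟨0, hn⟩⟩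
  obtain ⟨i, hi⟩ := Finite.exists_min fun i => 2 * (t i).re - N i
  obtain ⟨j, k, hk, hNk⟩ := exists_le_of_prod_Lfac_eq h i
  obtain ⟨i', l, hl, hNl⟩ := exists_le_of_prod_Lfac_eq (fun M s => (h M s).symm) j
  have hmin := hi i'
  have hre : (t i).re = (t i').re + l + k := by simp [hk, hl]
  have hsum : 2 * ((l : ℤ) + k) ≤ N i - N i' := by
    rify
    linarith
  obtain rfl : k = 0 := by omega
  exact ⟨i, j, by omega, by simpa using hk⟩
end

section
/- (Local converse theorem for GL_n(ℝ), parameter form.) Let p, q, p', q' ∈ ℕ, let ε : Fin p → ℕ and ε' : Fin p' → ℕ with ε i ≤ 1 and ε' j ≤ 1 for all i, j, let t : Fin p → ℂ, t' : Fin p' → ℂ, let N : Fin q → ℤ, N' : Fin q' → ℤ with N i ≥ 1 and N' j ≥ 1 for all i, j, and let u : Fin q → ℂ, u' : Fin q' → ℂ. Assume p + 2q = p' + 2q'. For (ε,δ) ∈ {0,1}² write γ(ε,δ) = 2 if ε = δ = 1 and γ(ε,δ) = 0 otherwise. Assume: (GL1) for every δ ∈ {0,1} and every s ∈ ℂ,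 ∏_{i : Fin p} π^{−(s + t i − γ(ε i, δ))/2}·Γ((s + t i − γ(ε i, δ))/2) · ∏_{i : Fin q} 2·(2π)^{−(s + u i − δ)}·Γ(s + u i − δ) equals the same expression with (p', ε', t', q', u') in place of (p, ε, t, q, u); and (GL2) for every integer M ≥ 0 and every s ∈ ℂ, ∏_{i : Fin p} 2·(2π)^{−(s + t i − ε i)}·Γ(s + t i − ε i) · ∏_{i : Fin q} 4·(2π)^{−2(s + u i) + min(N i, M)}·Γ(s + u i)·Γ(s + u i − min(N i, M)) equals the same expression with primed data. Then p = p', q = q', the multiset {(ε i, t i) : i ∈ Fin p} equals {(ε' j, t' j) : j ∈ Fin p'} in Multiset (ℕ × ℂ), and the multiset {(N i, u i) : i ∈ Fin q} equals {(N' j, u' j) : j ∈ Fin q'} in Multiset (ℤ × ℂ). -/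
open Complex

/-- `γ(ε, δ) = 2` if `ε = δ = 1` and `0` otherwise. -/
def gam (e d : ℕ) : ℕ := if e = 1 ∧ d = 1 then 2 else 0

/-- `1 / f` is analytic at `z` and vanishes there to order exactly `n`. -/
def HasPoleOrder (f : ℂ → ℂ) (z : ℂ) (n : ℕ) : Prop :=
  AnalyticAt ℂ (fun s => (f s)⁻¹) z ∧ analyticOrderAt (fun s => (f s)⁻¹) z = n

namespace HasPoleOrder

theorem unique {f : ℂ → ℂ} {z : ℂ} {m n : ℕ} (hm : HasPoleOrder f z m)
    (hn : HasPoleOrder f z n) : m = n := by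
  exact_mod_cast hm.2.symm.trans hn.2

theorem mul {f g : ℂ → ℂ} {z : ℂ} {m n : ℕ} (hf : HasPoleOrder f z m)
    (hg : HasPoleOrder g z n) : HasPoleOrder (fun s => f s * g s) z (m + n) := by
  have h : (fun s => (f s * g s)⁻¹) = (fun s => (f s)⁻¹) * fun s => (g s)⁻¹ := by
    ext s
    simp [mul_comm]
  rw [HasPoleOrder, h]
  refine ⟨hf.1.mul hg.1, ?_⟩
  rw [analyticOrderAt_mul hf.1 hg.1, hf.2, hg.2, Nat.cast_add]

theorem of_analyticAt_ne_zero {f : ℂ → ℂ} {z : ℂ} (hf : AnalyticAt ℂ f z) (h : f z ≠ 0) :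
    HasPoleOrder f z 0 := by
  have ha : AnalyticAt ℂ (fun s => (f s)⁻¹) z := hf.inv h
  refine ⟨ha, ?_⟩
  rw [Nat.cast_zero, ha.analyticOrderAt_eq_zero]
  exact inv_ne_zero h

theorem prod {ι : Type*} (S : Finset ι) {f : ι → ℂ → ℂ} {z : ℂ} {n : ι → ℕ}
    (h : ∀ i, HasPoleOrder (f i) z (n i)) :
    HasPoleOrder (fun s => ∏ i ∈ S, f i s) z (∑ i ∈ S, n i) := by
  classical
  induction S using Finset.induction_on with
  | empty => simpa using of_analyticAt_ne_zero (f := fun _ => 1) analyticAt_const one_ne_zero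
  | insert i S hi ih => simpa only [Finset.prod_insert hi, Finset.sum_insert hi] using (h i).mul ih

theorem comp {f g : ℂ → ℂ} {z : ℂ} {n : ℕ} (hf : HasPoleOrder f (g z) n)
    (hg : AnalyticAt ℂ g z) (hg' : deriv g z ≠ 0) : HasPoleOrder (fun s => f (g s)) z n :=
  ⟨hf.1.comp hg, (analyticOrderAt_comp_of_deriv_ne_zero hg hg').trans hf.2⟩

theorem const_cpow {b : ℂ} (hb : b ≠ 0) {g : ℂ → ℂ} {z : ℂ} (hg : AnalyticAt ℂ g z) :
    HasPoleOrder (fun s => b ^ g s) z 0 := by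
  refine of_analyticAt_ne_zero ?_ (by simp [Complex.cpow_eq_zero_iff, hb])
  simp only [Complex.cpow_def_of_ne_zero hb]
  fun_prop

end HasPoleOrder

/-- The order of the pole of `Γ` at `z`. -/
noncomputable def gammaPoleOrder (z : ℂ) : ℕ :=
  analyticOrderNatAt (fun s => (Complex.Gamma s)⁻¹) z

theorem analyticAt_inv_Gamma (z : ℂ) : AnalyticAt ℂ (fun s => (Complex.Gamma s)⁻¹) z :=
  Complex.differentiable_one_div_Gamma.analyticAt z

theorem analyticOrderAt_inv_Gamma (z : ℂ) :
    analyticOrderAt (fun s => (Complex.Gamma s)⁻¹) z =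
      (if z = 0 then 1 else 0) + analyticOrderAt (fun s => (Complex.Gamma s)⁻¹) (z + 1) := by
  have h : (fun s => (Complex.Gamma s)⁻¹) =
      (fun s => s - 0) * ((fun s => (Complex.Gamma s)⁻¹) ∘ fun s => s + 1) := by
    ext s
    simpa using Complex.one_div_Gamma_eq_self_mul_one_div_Gamma_add_one s
  have hd : deriv (fun s : ℂ => s + 1) z ≠ 0 := by simp
  conv_lhs => rw [h]
  rw [analyticOrderAt_mul (by fun_prop) ((analyticAt_inv_Gamma _).comp (by fun_prop)),
    analyticOrderAt_comp_of_deriv_ne_zero (by fun_prop) hd]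
  congr 1
  split_ifs with hz
  · subst hz
    exact analyticOrderAt_id_sub_const_self
  · exact analyticOrderAt_id_sub_const_of_ne hz

theorem analyticOrderAt_inv_Gamma_ne_top (z : ℂ) :
    analyticOrderAt (fun s => (Complex.Gamma s)⁻¹) z ≠ ⊤ := by
  obtain ⟨n, hn⟩ := exists_nat_gt (-z.re)
  induction n generalizing z with
  | zero =>
    have h : (Complex.Gamma z)⁻¹ ≠ 0 :=
      inv_ne_zero (Complex.Gamma_ne_zero_of_re_pos (by simpa using hn))
    rw [(analyticAt_inv_Gamma z).analyticOrderAt_eq_zero.2 h]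
    exact ENat.zero_ne_top
  | succ n ih =>
    have h := ih (z + 1) (by simp at hn ⊢; linarith)
    rw [analyticOrderAt_inv_Gamma]
    split_ifs <;> simp [h]

theorem hasPoleOrder_Gamma (z : ℂ) : HasPoleOrder Complex.Gamma z (gammaPoleOrder z) :=
  ⟨analyticAt_inv_Gamma z, (Nat.cast_analyticOrderNatAt (analyticOrderAt_inv_Gamma_ne_top z)).symm⟩

theorem gammaPoleOrder_eq (z : ℂ) :
    gammaPoleOrder z = (if z = 0 then 1 else 0) + gammaPoleOrder (z + 1) := by
  have h := analyticOrderAt_inv_Gamma z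
  rw [(hasPoleOrder_Gamma z).2, (hasPoleOrder_Gamma (z + 1)).2] at h
  split_ifs at h ⊢ <;> exact_mod_cast h

theorem hasPoleOrder_GammaR_factor (a z : ℂ) :
    HasPoleOrder (fun s => (Real.pi : ℂ) ^ (-((s + a) / 2)) * Complex.Gamma ((s + a) / 2)) z
      (gammaPoleOrder ((z + a) / 2)) := by
  have hpi : (Real.pi : ℂ) ≠ 0 := by exact_mod_cast Real.pi_ne_zero
  simpa using (HasPoleOrder.const_cpow hpi (g := fun s => -((s + a) / 2)) (by fun_prop)).mul
    ((hasPoleOrder_Gamma ((z + a) / 2)).comp (g := fun s => (s + a) / 2) (by fun_prop) (by simp))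

theorem hasPoleOrder_Gamma_add (a z : ℂ) :
    HasPoleOrder (fun s => Complex.Gamma (s + a)) z (gammaPoleOrder (z + a)) :=
  (hasPoleOrder_Gamma (z + a)).comp (g := fun s => s + a) (by fun_prop) (by simp)

theorem hasPoleOrder_const_mul_two_pi_cpow {c : ℂ} (hc : c ≠ 0) {g : ℂ → ℂ} {z : ℂ}
    (hg : AnalyticAt ℂ g z) : HasPoleOrder (fun s => c * (2 * (Real.pi : ℂ)) ^ g s) z 0 := by
  have hpi : 2 * (Real.pi : ℂ) ≠ 0 := by
    exact_mod_cast mul_ne_zero two_ne_zero Real.pi_ne_zero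
  simpa using (HasPoleOrder.of_analyticAt_ne_zero (f := fun _ => c) analyticAt_const hc).mul
    (HasPoleOrder.const_cpow hpi hg)

theorem hasPoleOrder_GammaC_factor (a z : ℂ) :
    HasPoleOrder (fun s => 2 * (2 * (Real.pi : ℂ)) ^ (-(s + a)) * Complex.Gamma (s + a)) z
      (gammaPoleOrder (z + a)) := by
  simpa using (hasPoleOrder_const_mul_two_pi_cpow two_ne_zero
    (g := fun s => -(s + a)) (by fun_prop)).mul (hasPoleOrder_Gamma_add a z)

theorem hasPoleOrder_GammaC_mul_factor (a m z : ℂ) :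
    HasPoleOrder (fun s => 4 * (2 * (Real.pi : ℂ)) ^ (-(2 * (s + a)) + m) *
      Complex.Gamma (s + a) * Complex.Gamma (s + a - m)) z
      (gammaPoleOrder (z + a) + gammaPoleOrder (z + a - m)) := by
  simpa [add_sub_assoc] using ((hasPoleOrder_const_mul_two_pi_cpow (by norm_num : (4 : ℂ) ≠ 0)
    (g := fun s => -(2 * (s + a)) + m) (by fun_prop)).mul (hasPoleOrder_Gamma_add a z)).mul
      (hasPoleOrder_Gamma_add (a - m) z)

/-- The sum of `g` over the family `x`, minus its sum over the family `x'`. -/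
def signedSum {α : Type*} {m n : ℕ} (x : Fin m → α) (x' : Fin n → α) (g : α → ℤ) : ℤ :=
  ∑ i, g (x i) - ∑ j, g (x' j)

section signedSum

variable {α : Type*} {m n : ℕ} {x : Fin m → α} {x' : Fin n → α}

theorem signedSum_add (g h : α → ℤ) :
    signedSum x x' (fun a => g a + h a) = signedSum x x' g + signedSum x x' h := by
  simp only [signedSum, Finset.sum_add_distrib]
  ring

theorem signedSum_sub (g h : α → ℤ) :
    signedSum x x' (fun a => g a - h a) = signedSum x x' g - signedSum x x' h := by
  simp only [signedSum, Finset.sum_sub_distrib]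
  ring

theorem signedSum_congr {g h : α → ℤ} {P : α → Prop} (H : ∀ a, P a → g a = h a)
    (hx : ∀ i, P (x i)) (hx' : ∀ j, P (x' j)) : signedSum x x' g = signedSum x x' h := by
  simp only [signedSum, H _ (hx _), H _ (hx' _)]

theorem signedSum_eq_zero {g : α → ℤ} (H : ∀ i, g (x i) = 0) (H' : ∀ j, g (x' j) = 0) :
    signedSum x x' g = 0 := by
  simp [signedSum, H, H']

theorem finite_support_signedSum {β : Type*} {g : β → α → ℤ} (φ : α → β)
    (hg : ∀ z a, φ a ≠ z → g z a = 0) :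
    (Function.support fun z => signedSum x x' (g z)).Finite := by
  refine ((Set.finite_range fun i => φ (x i)).union
    (Set.finite_range fun j => φ (x' j))).subset fun z hz => ?_
  by_contra hmem
  simp only [Set.mem_union, Set.mem_range, not_or, not_exists] at hmem
  exact hz (signedSum_eq_zero (fun i => hg _ _ (hmem.1 i)) fun j => hg _ _ (hmem.2 j))

theorem map_univ_eq_of_signedSum_eq_zero [DecidableEq α]
    (h : ∀ a, signedSum x x' (fun b => if b = a then 1 else 0) = 0) :
    Finset.univ.val.map x = Finset.univ.val.map x' := by
  have key : ∀ {k : ℕ} (y : Fin k → α) (a : α),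
      ((Multiset.count a (Finset.univ.val.map y) : ℕ) : ℤ) =
        ∑ i, if y i = a then 1 else 0 := by
    intro k y a
    rw [Multiset.count_map, Finset.sum_boole]
    simp only [eq_comm (a := a)]
    rfl
  refine Multiset.ext' fun a => ?_
  have ha := h a
  rw [signedSum, sub_eq_zero, ← key, ← key] at ha
  exact_mod_cast ha

end signedSum

theorem eq_zero_of_finite_support_of_periodic {h : ℂ → ℤ} (hfin : (Function.support h).Finite)
    {c : ℂ} (hc : c ≠ 0) (hper : ∀ z, h (z + c) = h z) (z : ℂ) : h z = 0 := by
  by_contra hz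
  have hn : ∀ n : ℕ, h (z + n * c) = h z := by
    intro n
    induction n with
    | zero => simp
    | succ n ih => rw [← ih, ← hper (z + n * c)]; congr 1; push_cast; ring
  refine Set.infinite_of_injective_forall_mem (f := fun n : ℕ => z + n * c) ?_ ?_ hfin
  · intro a b hab
    simpa [hc] using hab
  · intro n
    simpa [Function.mem_support, hn n] using hz

section parameters

variable {p q p' q' : ℕ} {x : Fin p → ℕ × ℂ} {x' : Fin p' → ℕ × ℂ}
  {y : Fin q → ℤ × ℂ} {y' : Fin q' → ℤ × ℂ}

theorem signedSum_indicator_of_GL1 (hx : ∀ i, (x i).1 ≤ 1) (hx' : ∀ j, (x' j).1 ≤ 1)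
    (hy : ∀ i, 1 ≤ (y i).1) (hy' : ∀ j, 1 ≤ (y' j).1) (δ : ℕ)
    (h : ∀ s : ℂ, signedSum x x' (fun a => (gammaPoleOrder ((s + a.2 - gam a.1 δ) / 2) : ℤ)) +
      signedSum y y' (fun b => (gammaPoleOrder (s + b.2 - δ) : ℤ)) = 0) (z : ℂ) :
    signedSum x x' (fun a => if a = (0, z) then 1 else 0) +
      signedSum x x' (fun a => if a = (1, z + gam 1 δ) then 1 else 0) +
      (signedSum y y' (fun b => if 0 < b.1 ∧ b.2 = z + δ then 1 else 0) +
      signedSum y y' (fun b => if 0 < b.1 ∧ b.2 = z + δ - 1 then 1 else 0)) = 0 := by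
  have hX : ∀ a : ℕ × ℂ, a.1 ≤ 1 → (gammaPoleOrder ((-z + a.2 - gam a.1 δ) / 2) : ℤ) =
      ((if a = (0, z) then 1 else 0) + if a = (1, z + gam 1 δ) then 1 else 0) +
        (gammaPoleOrder ((-z + 2 + a.2 - gam a.1 δ) / 2) : ℤ) := by
    rintro ⟨e, t⟩ he
    rw [gammaPoleOrder_eq, show (-z + t - gam e δ) / 2 + 1 = (-z + 2 + t - gam e δ) / 2 by ring]
    have hz : (-z + t - gam e δ) / 2 = 0 ↔ t = z + gam e δ := by
      grind
    simp only [hz]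
    obtain rfl | rfl : e = 0 ∨ e = 1 := by simp only at he; omega
    all_goals simp [gam]
  have hY : ∀ b : ℤ × ℂ, 1 ≤ b.1 → (gammaPoleOrder (-z + b.2 - δ) : ℤ) =
      ((if 0 < b.1 ∧ b.2 = z + δ then 1 else 0) + if 0 < b.1 ∧ b.2 = z + δ - 1 then 1 else 0) +
        (gammaPoleOrder (-z + 2 + b.2 - δ) : ℤ) := by
    rintro ⟨k, t⟩ hk
    rw [gammaPoleOrder_eq, gammaPoleOrder_eq (_ + 1),
      show -z + t - δ + 1 + 1 = -z + 2 + t - δ by ring]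
    have hz : -z + t - δ = 0 ↔ t = z + δ := by grind
    have hz' : -z + t - δ + 1 = 0 ↔ t = z + δ - 1 := by grind
    have hk0 : 0 < k := by simp only at hk; omega
    simp only [hz, hz', hk0, true_and]
    push_cast
    ring
  have h0 := h (-z)
  rw [signedSum_congr hX hx hx', signedSum_congr hY hy hy'] at h0
  simp only [signedSum_add] at h0
  linarith [h (-z + 2)]

theorem signedSum_snd_eq_add_min_of_GL2
    (h : ∀ M : ℤ, 0 ≤ M → ∀ s : ℂ,
      signedSum x x' (fun a => (gammaPoleOrder (s + a.2 - a.1) : ℤ)) +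
      signedSum y y' (fun b => (gammaPoleOrder (s + b.2) : ℤ) +
        (gammaPoleOrder (s + b.2 - (min b.1 M : ℤ)) : ℤ)) = 0)
    {M M' : ℤ} (hM : 0 ≤ M) (hM' : 0 ≤ M') (z : ℂ) :
    signedSum y y' (fun b => if b.2 = z + (min b.1 M : ℤ) then 1 else 0) =
      signedSum y y' (fun b => if b.2 = z + (min b.1 M' : ℤ) then 1 else 0) := by
  have key : ∀ m : ℤ, signedSum y y' (fun b => if b.2 = z + (min b.1 m : ℤ) then 1 else 0) =
      signedSum y y' (fun b => (gammaPoleOrder (-z + b.2 - (min b.1 m : ℤ)) : ℤ)) -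
      signedSum y y' (fun b => (gammaPoleOrder (-z + 1 + b.2 - (min b.1 m : ℤ)) : ℤ)) := by
    intro m
    rw [← signedSum_sub]
    congr 1
    ext b
    rw [gammaPoleOrder_eq (-z + b.2 - _),
      show -z + b.2 - (min b.1 m : ℤ) + 1 = -z + 1 + b.2 - (min b.1 m : ℤ) by ring]
    have hz : -z + b.2 - (min b.1 m : ℤ) = 0 ↔ b.2 = z + (min b.1 m : ℤ) := by grind
    simp only [hz]
    push_cast
    ring
  have h₁ := h M hM (-z)
  have h₂ := h M hM (-z + 1)
  have h₃ := h M' hM' (-z)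
  have h₄ := h M' hM' (-z + 1)
  rw [signedSum_add] at h₁ h₂ h₃ h₄
  rw [key, key]
  linarith

theorem signedSum_lt_fst_eq_zero_of_GL2
    (h : ∀ M : ℤ, 0 ≤ M → ∀ s : ℂ,
      signedSum x x' (fun a => (gammaPoleOrder (s + a.2 - a.1) : ℤ)) +
      signedSum y y' (fun b => (gammaPoleOrder (s + b.2) : ℤ) +
        (gammaPoleOrder (s + b.2 - (min b.1 M : ℤ)) : ℤ)) = 0)
    {M : ℤ} (hM : 0 ≤ M) (z : ℂ) :
    signedSum y y' (fun b => if M < b.1 ∧ b.2 = z then 1 else 0) = 0 := by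
  refine eq_zero_of_finite_support_of_periodic
    (h := fun z => signedSum y y' (fun b => if M < b.1 ∧ b.2 = z then 1 else 0))
    (finite_support_signedSum Prod.snd fun z a ha => by simp [ha]) one_ne_zero (fun z => ?_) z
  have h₁ := signedSum_snd_eq_add_min_of_GL2 h (M := M + 1) (by omega) hM (z - M)
  rw [← sub_eq_zero, ← signedSum_sub] at h₁ ⊢
  refine Eq.trans ?_ h₁
  congr 1
  ext ⟨k, t⟩
  rcases lt_or_ge M k with hk | hk
  · rw [min_eq_right (by simpa using hk), min_eq_right hk.le]
    simp only [hk, true_and, Int.cast_add, Int.cast_one]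
    rw [show z - M + (M + 1) = z + 1 by ring, show z - M + M = z by ring]
  · rw [min_eq_left (by simp only; omega), min_eq_left hk]
    simp [hk.not_gt]

theorem map_univ_eq_of_gammaPoleOrder_eq (hx : ∀ i, (x i).1 ≤ 1) (hx' : ∀ j, (x' j).1 ≤ 1)
    (hy : ∀ i, 1 ≤ (y i).1) (hy' : ∀ j, 1 ≤ (y' j).1)
    (h₁ : ∀ δ : ℕ, δ ≤ 1 → ∀ s : ℂ,
      signedSum x x' (fun a => (gammaPoleOrder ((s + a.2 - gam a.1 δ) / 2) : ℤ)) +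
      signedSum y y' (fun b => (gammaPoleOrder (s + b.2 - δ) : ℤ)) = 0)
    (h₂ : ∀ M : ℤ, 0 ≤ M → ∀ s : ℂ,
      signedSum x x' (fun a => (gammaPoleOrder (s + a.2 - a.1) : ℤ)) +
      signedSum y y' (fun b => (gammaPoleOrder (s + b.2) : ℤ) +
        (gammaPoleOrder (s + b.2 - (min b.1 M : ℤ)) : ℤ)) = 0) :
    Finset.univ.val.map x = Finset.univ.val.map x' ∧
      Finset.univ.val.map y = Finset.univ.val.map y' := by
  have hU := fun (M : ℤ) (hM : 0 ≤ M) => signedSum_lt_fst_eq_zero_of_GL2 h₂ hM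
  have hT₀ := signedSum_indicator_of_GL1 hx hx' hy hy' 0 (h₁ 0 zero_le_one)
  have hT₁ := signedSum_indicator_of_GL1 hx hx' hy hy' 1 (h₁ 1 le_rfl)
  simp only [hU 0 le_rfl, gam, add_zero] at hT₀ hT₁
  norm_num at hT₀ hT₁
  have hone : ∀ z, signedSum x x' (fun a => if a = (1, z) then 1 else 0) = 0 :=
    eq_zero_of_finite_support_of_periodic
      (finite_support_signedSum Prod.snd fun z a ha => if_neg fun h => ha (by rw [h]))
      two_ne_zero fun z => by linarith [hT₀ z, hT₁ z]
  refine ⟨map_univ_eq_of_signedSum_eq_zero fun ⟨e, z⟩ => ?_,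
    map_univ_eq_of_signedSum_eq_zero fun ⟨k, z⟩ => ?_⟩
  · match e with
    | 0 => linarith [hT₀ z, hone z]
    | 1 => exact hone z
    | e + 2 =>
      exact signedSum_eq_zero (fun i => if_neg fun h => by have := hx i; simp [h] at this)
        fun j => if_neg fun h => by have := hx' j; simp [h] at this
  · rcases lt_or_ge k 1 with hk | hk
    · exact signedSum_eq_zero
        (fun i => if_neg fun h => by have := hy i; simp only [h] at this; omega)
        fun j => if_neg fun h => by have := hy' j; simp only [h] at this; omega
    · have h := signedSum_sub (x := y) (x' := y')
        (fun b => if k - 1 < b.1 ∧ b.2 = z then 1 else 0)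
        (fun b => if k < b.1 ∧ b.2 = z then 1 else 0)
      rw [hU _ (by omega), hU _ (by omega), sub_zero] at h
      refine Eq.trans ?_ h
      congr 1
      ext ⟨l, t⟩
      simp only [Prod.mk.injEq]
      by_cases ht : t = z
      · simp only [ht, and_true]
        split_ifs <;> omega
      · simp [ht]

end parameters

theorem local_converse_GLn_real
    (p q p' q' : ℕ)
    (ε : Fin p → ℕ) (ε' : Fin p' → ℕ)
    (hε : ∀ i, ε i ≤ 1) (hε' : ∀ j, ε' j ≤ 1)
    (t : Fin p → ℂ) (t' : Fin p' → ℂ)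
    (N : Fin q → ℤ) (N' : Fin q' → ℤ)
    (hN : ∀ i, 1 ≤ N i) (hN' : ∀ j, 1 ≤ N' j)
    (u : Fin q → ℂ) (u' : Fin q' → ℂ)
    (hdim : p + 2 * q = p' + 2 * q')
    (hGL1 : ∀ δ : ℕ, δ ≤ 1 → ∀ s : ℂ,
      (∏ i : Fin p, (Real.pi : ℂ) ^ (-((s + t i - (gam (ε i) δ : ℂ)) / 2)) *
          Complex.Gamma ((s + t i - (gam (ε i) δ : ℂ)) / 2)) *
        ∏ i : Fin q, 2 * (2 * (Real.pi : ℂ)) ^ (-(s + u i - (δ : ℂ))) *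
          Complex.Gamma (s + u i - (δ : ℂ))
      = (∏ j : Fin p', (Real.pi : ℂ) ^ (-((s + t' j - (gam (ε' j) δ : ℂ)) / 2)) *
          Complex.Gamma ((s + t' j - (gam (ε' j) δ : ℂ)) / 2)) *
        ∏ j : Fin q', 2 * (2 * (Real.pi : ℂ)) ^ (-(s + u' j - (δ : ℂ))) *
          Complex.Gamma (s + u' j - (δ : ℂ)))
    (hGL2 : ∀ M : ℤ, 0 ≤ M → ∀ s : ℂ,
      (∏ i : Fin p, 2 * (2 * (Real.pi : ℂ)) ^ (-(s + t i - (ε i : ℂ))) *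
          Complex.Gamma (s + t i - (ε i : ℂ))) *
        ∏ i : Fin q, 4 * (2 * (Real.pi : ℂ)) ^ (-(2 * (s + u i)) + ((min (N i) M : ℤ) : ℂ)) *
          Complex.Gamma (s + u i) * Complex.Gamma (s + u i - ((min (N i) M : ℤ) : ℂ))
      = (∏ j : Fin p', 2 * (2 * (Real.pi : ℂ)) ^ (-(s + t' j - (ε' j : ℂ))) *
          Complex.Gamma (s + t' j - (ε' j : ℂ))) *
        ∏ j : Fin q', 4 * (2 * (Real.pi : ℂ)) ^ (-(2 * (s + u' j)) + ((min (N' j) M : ℤ) : ℂ)) *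
          Complex.Gamma (s + u' j) * Complex.Gamma (s + u' j - ((min (N' j) M : ℤ) : ℂ))) :
    p = p' ∧ q = q' ∧
      Finset.univ.val.map (fun i => (ε i, t i)) = Finset.univ.val.map (fun j => (ε' j, t' j)) ∧
      Finset.univ.val.map (fun i => (N i, u i)) = Finset.univ.val.map (fun j => (N' j, u' j)) := by
  have h₁ : ∀ δ : ℕ, δ ≤ 1 → ∀ s : ℂ,
      signedSum (fun i => (ε i, t i)) (fun j => (ε' j, t' j))
        (fun a => (gammaPoleOrder ((s + a.2 - gam a.1 δ) / 2) : ℤ)) +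
      signedSum (fun i => (N i, u i)) (fun j => (N' j, u' j))
        (fun b => (gammaPoleOrder (s + b.2 - δ) : ℤ)) = 0 := by
    intro δ hδ s
    have key : ∀ {m n : ℕ} (e : Fin m → ℕ) (v : Fin m → ℂ) (w : Fin n → ℂ), HasPoleOrder
        (fun s => (∏ i, (Real.pi : ℂ) ^ (-((s + v i - (gam (e i) δ : ℂ)) / 2)) *
          Complex.Gamma ((s + v i - (gam (e i) δ : ℂ)) / 2)) *
        ∏ i, 2 * (2 * (Real.pi : ℂ)) ^ (-(s + w i - (δ : ℂ))) *
          Complex.Gamma (s + w i - (δ : ℂ))) s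
        (∑ i, gammaPoleOrder ((s + v i - gam (e i) δ) / 2) +
          ∑ i, gammaPoleOrder (s + w i - δ)) := by
      intro m n e v w
      simp only [add_sub_assoc]
      exact (HasPoleOrder.prod _ fun i => hasPoleOrder_GammaR_factor _ _).mul
        (HasPoleOrder.prod _ fun i => hasPoleOrder_GammaC_factor _ _)
    have h := key ε t u
    rw [funext (hGL1 δ hδ)] at h
    have h' := h.unique (key ε' t' u')
    zify at h'
    simp only [signedSum]
    linarith
  have h₂ : ∀ M : ℤ, 0 ≤ M → ∀ s : ℂ,
      signedSum (fun i => (ε i, t i)) (fun j => (ε' j, t' j))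
        (fun a => (gammaPoleOrder (s + a.2 - a.1) : ℤ)) +
      signedSum (fun i => (N i, u i)) (fun j => (N' j, u' j))
        (fun b => (gammaPoleOrder (s + b.2) : ℤ) +
          (gammaPoleOrder (s + b.2 - (min b.1 M : ℤ)) : ℤ)) = 0 := by
    intro M hM s
    have key : ∀ {m n : ℕ} (e : Fin m → ℕ) (v : Fin m → ℂ) (k : Fin n → ℤ) (w : Fin n → ℂ),
        HasPoleOrder
        (fun s => (∏ i, 2 * (2 * (Real.pi : ℂ)) ^ (-(s + v i - (e i : ℂ))) *
          Complex.Gamma (s + v i - (e i : ℂ))) *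
        ∏ i, 4 * (2 * (Real.pi : ℂ)) ^ (-(2 * (s + w i)) + ((min (k i) M : ℤ) : ℂ)) *
          Complex.Gamma (s + w i) * Complex.Gamma (s + w i - ((min (k i) M : ℤ) : ℂ))) s
        (∑ i, gammaPoleOrder (s + v i - e i) +
          ∑ i, (gammaPoleOrder (s + w i) + gammaPoleOrder (s + w i - (min (k i) M : ℤ)))) := by
      intro m n e v k w
      refine .mul (.prod _ fun i => ?_)
        (.prod _ fun i => hasPoleOrder_GammaC_mul_factor _ _ _)
      simpa only [add_sub_assoc] using hasPoleOrder_GammaC_factor (v i - e i) s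
    have h := key ε t N u
    rw [funext (hGL2 M hM)] at h
    have h' := h.unique (key ε' t' N' u')
    zify at h'
    simp only [signedSum]
    linarith
  obtain ⟨hx, hy⟩ := map_univ_eq_of_gammaPoleOrder_eq hε hε' hN hN' h₁ h₂
  exact ⟨by simpa using congrArg Multiset.card hx, by simpa using congrArg Multiset.card hy, hx, hy⟩
end

section
/- (Step 1 of the real case, multiset form.) Let A, A', B, B' be finite multisets of complex numbers (elements of Multiset ℂ). If A + B + B = A' + B' + B' and A + B + B.map(x ↦ x − 1) = A' + B' + B'.map(x ↦ x − 1), then A = A' and B = B'. -/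
theorem Multiset.count_map_sub_one (B : Multiset ℂ) (x : ℂ) :
    (B.map (fun y => y - 1)).count x = B.count (x + 1) := by
  have h := Multiset.count_map_eq_count' (fun y : ℂ => y - 1) B sub_left_injective (x + 1)
  simpa using h

/-- Two finite multisets of complex numbers whose multiplicities differ by a function of
period one are equal. -/
theorem Multiset.eq_of_count_sub_count_periodic {B B' : Multiset ℂ}
    (h : ∀ x, (B.count x : ℤ) - B'.count x = B.count (x + 1) - B'.count (x + 1)) :
    B = B' := by
  ext x
  have hn (n : ℕ) : (B.count x : ℤ) - B'.count x = B.count (x + n) - B'.count (x + n) := by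
    induction n with
    | zero => simp
    | succ n ih => rw [ih, h, Nat.cast_succ, add_assoc]
  have hinj : Function.Injective (fun n : ℕ => x + (n : ℂ)) :=
    (add_right_injective x).comp Nat.cast_injective
  obtain ⟨n, hmem⟩ :=
    Infinite.exists_notMem_finset ((B + B').toFinset.preimage _ hinj.injOn)
  simp only [Finset.mem_preimage, Multiset.mem_toFinset, Multiset.mem_add, not_or] at hmem
  have hx := hn n
  rw [Multiset.count_eq_zero_of_notMem hmem.1, Multiset.count_eq_zero_of_notMem hmem.2] at hx
  lia

theorem real_case_step1_multisets (A A' B B' : Multiset ℂ)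
    (h0 : A + B + B = A' + B' + B')
    (h1 : A + B + B.map (fun x => x - 1) = A' + B' + B'.map (fun x => x - 1)) :
    A = A' ∧ B = B' := by
  have hB : B = B' := by
    refine Multiset.eq_of_count_sub_count_periodic fun x => ?_
    have e0 := congrArg (Multiset.count x) h0
    have e1 := congrArg (Multiset.count x) h1
    simp only [Multiset.count_add, Multiset.count_map_sub_one] at e0 e1
    lia
  subst hB
  exact ⟨add_right_cancel (add_right_cancel h0), rfl⟩
end

section
/- (Step 2 of the real case, combinatorial form.) Let p ∈ ℕ, let ε, ε' : Fin p → ℕ with ε i ≤ 1 and ε' i ≤ 1 for all i, and let t, t' : Fin p → ℂ. If the multiset {t i : i ∈ Fin p} equals the multiset {t' i : i ∈ Fin p}, and the multiset {t i − ε i : i ∈ Fin p} equals the multiset {t' i − ε' i : i ∈ Fin p} (in Multiset ℂ, with ε i coerced to ℂ), then the multiset of pairs {(ε i, t i) : i ∈ Fin p} equals {(ε' i, t' i) : i ∈ Fin p} in Multiset (ℕ × ℂ). -/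
/-- Splitting the fibre of `snd` over `z` according to the first coordinate. -/
lemma count_map_snd_of_fst_le_one (M : Multiset (ℕ × ℂ)) (hM : ∀ x ∈ M, x.1 ≤ 1) (z : ℂ) :
    (M.map Prod.snd).count z = M.count (0, z) + M.count (1, z) := by
  induction M using Multiset.induction with
  | empty => simp
  | cons a M ih =>
    obtain ⟨e, w⟩ := a
    have he : e ≤ 1 := hM (e, w) (Multiset.mem_cons_self _ _)
    rw [Multiset.map_cons, Multiset.count_cons, Multiset.count_cons, Multiset.count_cons,
      ih fun x hx => hM x (Multiset.mem_cons_of_mem hx)]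
    interval_cases e <;> by_cases h : z = w <;> simp [h] <;> ring

/-- Splitting the fibre of `(e, w) ↦ w - e` over `z` according to the first coordinate. -/
lemma count_map_snd_sub_fst_of_fst_le_one (M : Multiset (ℕ × ℂ)) (hM : ∀ x ∈ M, x.1 ≤ 1)
    (z : ℂ) :
    (M.map fun x => x.2 - (x.1 : ℂ)).count z = M.count (0, z) + M.count (1, z + 1) := by
  induction M using Multiset.induction with
  | empty => simp
  | cons a M ih =>
    obtain ⟨e, w⟩ := a
    have he : e ≤ 1 := hM (e, w) (Multiset.mem_cons_self _ _)
    rw [Multiset.map_cons, Multiset.count_cons, Multiset.count_cons, Multiset.count_cons,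
      ih fun x hx => hM x (Multiset.mem_cons_of_mem hx)]
    interval_cases e
    · by_cases h : z = w <;> simp [h]; ring
    · by_cases h : z + 1 = w <;> simp [h, eq_sub_iff_add_eq]; ring

/-- A multiset of pairs in `{0, 1} × ℂ` is determined by its images under `(e, w) ↦ w` and
`(e, w) ↦ w - e`. -/
lemma eq_of_map_snd_eq_of_map_snd_sub_fst_eq (M N : Multiset (ℕ × ℂ))
    (hM : ∀ x ∈ M, x.1 ≤ 1) (hN : ∀ x ∈ N, x.1 ≤ 1)
    (h : M.map Prod.snd = N.map Prod.snd)
    (h' : (M.map fun x => x.2 - (x.1 : ℂ)) = N.map fun x => x.2 - (x.1 : ℂ)) : M = N := by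
  have fibre (z : ℂ) :
      M.count (0, z) + M.count (1, z) = N.count (0, z) + N.count (1, z) := by
    rw [← count_map_snd_of_fst_le_one M hM, ← count_map_snd_of_fst_le_one N hN, h]
  have fibre_sub (z : ℂ) :
      M.count (0, z) + M.count (1, z + 1) = N.count (0, z) + N.count (1, z + 1) := by
    rw [← count_map_snd_sub_fst_of_fst_le_one M hM,
      ← count_map_snd_sub_fst_of_fst_le_one N hN, h']
  have count_one (z : ℂ) : M.count (1, z) = N.count (1, z) := by
    have periodic (n : ℕ) : M.count (1, z + n) + N.count (1, z)
        = N.count (1, z + n) + M.count (1, z) := by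
      induction n with
      | zero => simp [add_comm]
      | succ n ih =>
        have h₁ := fibre (z + n)
        have h₂ := fibre_sub (z + n)
        rw [Nat.cast_succ, ← add_assoc]
        omega
    have inj : Function.Injective fun n : ℕ => ((1, z + n) : ℕ × ℂ) := fun m n hmn => by
      simpa using hmn
    obtain ⟨n, hn⟩ := Infinite.exists_notMem_finset
      ((M + N).toFinset.preimage _ inj.injOn)
    simp only [Finset.mem_preimage, Multiset.mem_toFinset, Multiset.mem_add, not_or] at hn
    have := periodic n
    rw [Multiset.count_eq_zero_of_notMem hn.1, Multiset.count_eq_zero_of_notMem hn.2] at this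
    omega
  ext ⟨e, z⟩
  match e with
  | 0 =>
    have h₁ := fibre z
    have h₂ := count_one z
    omega
  | 1 => exact count_one z
  | e + 2 =>
    rw [Multiset.count_eq_zero_of_notMem fun hx => by simpa using hM _ hx,
      Multiset.count_eq_zero_of_notMem fun hx => by simpa using hN _ hx]

theorem real_case_step2 (p : ℕ) (ε ε' : Fin p → ℕ)
    (hε : ∀ i, ε i ≤ 1) (hε' : ∀ i, ε' i ≤ 1) (t t' : Fin p → ℂ)
    (ht : Finset.univ.val.map t = Finset.univ.val.map t')
    (htε : Finset.univ.val.map (fun i => t i - (ε i : ℂ))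
      = Finset.univ.val.map (fun i => t' i - (ε' i : ℂ))) :
    Finset.univ.val.map (fun i => (ε i, t i)) = Finset.univ.val.map (fun i => (ε' i, t' i)) := by
  apply eq_of_map_snd_eq_of_map_snd_sub_fst_eq
  · simpa using hε
  · simpa using hε'
  · simpa only [Multiset.map_map, Function.comp_def] using ht
  · simpa only [Multiset.map_map, Function.comp_def] using htε
end

section
/- (Variant of Step 2 with shifts by 2, used for the GL_3(ℝ) proposition.) Let p ∈ ℕ, let ε, ε' : Fin p → ℕ with ε i ≤ 1 and ε' i ≤ 1 for all i, and let t, t' : Fin p → ℂ. If the multiset {t i : i ∈ Fin p} equals the multiset {t' i : i ∈ Fin p}, and the multiset {t i − 2·ε i : i ∈ Fin p} equals the multiset {t' i − 2·ε' i : i ∈ Fin p} (in Multiset ℂ), then the multiset of pairs {(ε i, t i) : i ∈ Fin p} equals {(ε' i, t' i) : i ∈ Fin p} in Multiset (ℕ × ℂ). -/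
theorem Multiset.count_map_snd_of_fst_le_one {α : Type*} [DecidableEq α] (S : Multiset (ℕ × α))
    (hS : ∀ z ∈ S, z.1 ≤ 1) (x : α) :
    (S.map Prod.snd).count x = S.count (0, x) + S.count (1, x) := by
  induction S using Multiset.induction with
  | empty => simp
  | cons z S ih =>
    obtain ⟨e, s⟩ := z
    have he : e ≤ 1 := hS (e, s) (by simp)
    rw [Multiset.map_cons, Multiset.count_cons, Multiset.count_cons, Multiset.count_cons,
      ih fun z hz => hS z (Multiset.mem_cons_of_mem hz)]
    by_cases h : x = s <;> interval_cases e <;> simp [h] <;> omega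

theorem Multiset.count_map_sub_of_fst_le_one {R : Type*} [Ring R] [DecidableEq R] (c : R)
    (S : Multiset (ℕ × R)) (hS : ∀ z ∈ S, z.1 ≤ 1) (x : R) :
    (S.map fun z => z.2 - c * (z.1 : R)).count x = S.count (0, x) + S.count (1, x + c) := by
  induction S using Multiset.induction with
  | empty => simp
  | cons z S ih =>
    obtain ⟨e, s⟩ := z
    have he : e ≤ 1 := hS (e, s) (by simp)
    rw [Multiset.map_cons, Multiset.count_cons, Multiset.count_cons, Multiset.count_cons,
      ih fun z hz => hS z (Multiset.mem_cons_of_mem hz)]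
    interval_cases e
    · by_cases h : x = s <;> simp [h]; omega
    · by_cases h : x + c = s <;> simp [h, eq_sub_iff_add_eq]; omega

/-- A multiset of pairs `(e, s)` with `e ≤ 1` is determined by the multisets of the `s` and of the
`s - c * e`, as soon as `c ≠ 0` in a domain of characteristic zero. -/
theorem Multiset.eq_of_map_snd_eq_of_map_sub_eq {R : Type*} [Ring R] [IsDomain R] [CharZero R]
    {c : R} (hc : c ≠ 0) {S T : Multiset (ℕ × R)}
    (hS : ∀ z ∈ S, z.1 ≤ 1) (hT : ∀ z ∈ T, z.1 ≤ 1)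
    (hsnd : S.map Prod.snd = T.map Prod.snd)
    (hsub : (S.map fun z => z.2 - c * (z.1 : R)) = T.map fun z => z.2 - c * (z.1 : R)) :
    S = T := by
  classical
  have hadd (x : R) : S.count (0, x) + S.count (1, x) = T.count (0, x) + T.count (1, x) := by
    rw [← count_map_snd_of_fst_le_one S hS, ← count_map_snd_of_fst_le_one T hT, hsnd]
  have hshift (x : R) :
      S.count (0, x) + S.count (1, x + c) = T.count (0, x) + T.count (1, x + c) := by
    rw [← count_map_sub_of_fst_le_one c S hS, ← count_map_sub_of_fst_le_one c T hT, hsub]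
  have hone (x : R) : S.count (1, x) = T.count (1, x) := by
    have hperiodic (n : ℕ) :
        S.count (1, x) + T.count (1, x + n * c) = T.count (1, x) + S.count (1, x + n * c) := by
      induction n with
      | zero => simp [add_comm]
      | succ n ih =>
        have h₁ := hadd (x + n * c)
        have h₂ := hshift (x + n * c)
        rw [show x + ((n + 1 : ℕ) : R) * c = x + n * c + c by push_cast; rw [add_mul, one_mul, add_assoc]]
        omega
    have hinj : Function.Injective fun n : ℕ => ((1, x + n * c) : ℕ × R) := by
      intro m n h
      simpa [hc] using h
    obtain ⟨_, ⟨n, rfl⟩, hn⟩ :=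
      (Set.infinite_range_of_injective hinj).exists_notMem_finset (S + T).toFinset
    simp only [mem_toFinset, mem_add, not_or] at hn
    simpa [count_eq_zero_of_notMem hn.1, count_eq_zero_of_notMem hn.2] using hperiodic n
  ext ⟨e, x⟩
  match e with
  | 0 => have := hadd x; have := hone x; omega
  | 1 => exact hone x
  | e + 2 =>
    rw [count_eq_zero_of_notMem fun h => by simpa using hS _ h,
      count_eq_zero_of_notMem fun h => by simpa using hT _ h]

theorem real_case_step2_shift_two (p : ℕ) (ε ε' : Fin p → ℕ)
    (hε : ∀ i, ε i ≤ 1) (hε' : ∀ i, ε' i ≤ 1) (t t' : Fin p → ℂ)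
    (ht : Finset.univ.val.map t = Finset.univ.val.map t')
    (htε : Finset.univ.val.map (fun i => t i - 2 * (ε i : ℂ))
      = Finset.univ.val.map (fun i => t' i - 2 * (ε' i : ℂ))) :
    Finset.univ.val.map (fun i => (ε i, t i)) = Finset.univ.val.map (fun i => (ε' i, t' i)) := by
  apply Multiset.eq_of_map_snd_eq_of_map_sub_eq (two_ne_zero (α := ℂ))
  · simpa using hε
  · simpa using hε'
  · simpa [Multiset.map_map, Function.comp_def] using ht
  · simpa only [Multiset.map_map, Function.comp_def] using htε
end

section
/- (Step 3 of the real case: equality of minimal parameters.) Let q ∈ ℕ with q ≥ 1, let N, N' : Fin q → ℤ with N i ≥ 1 and N' i ≥ 1 for all i, and let u, u' : Fin q → ℂ. Assume that for every integer M ≥ 0 and every s ∈ ℂ, ∏_{i : Fin q} 4·(2π)^{−2(s + u i) + min(N i, M)}·Γ(s + u i)·Γ(s + u i − min(N i, M)) = ∏_{i : Fin q} 4·(2π)^{−2(s + u' i) + min(N' i, M)}·Γ(s + u' i)·Γ(s + u' i − min(N' i, M)). Then min_{i ∈ Fin q} N i = min_{i ∈ Fin q} N' i. -/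
open Complex

open Polynomial in
/-- The factor `(s + v - M - 1) / (2π)` by which a single archimedean factor changes between `M + 1`
and `M` when `M < n`, as a polynomial in `s`; it is `1` when `n ≤ M`. -/
noncomputable def stepPoly (M n : ℤ) (v : ℂ) : ℂ[X] :=
  if M < n then C (2 * (Real.pi : ℂ))⁻¹ * (X + C (v - M - 1)) else 1

lemma two_pi_ne_zero_complex : (2 * (Real.pi : ℂ)) ≠ 0 :=
  mul_ne_zero two_ne_zero (ofReal_ne_zero.mpr Real.pi_ne_zero)

lemma stepPoly_ne_zero (M n : ℤ) (v : ℂ) : stepPoly M n v ≠ 0 := by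
  unfold stepPoly
  split_ifs
  · exact mul_ne_zero (Polynomial.C_ne_zero.mpr (inv_ne_zero two_pi_ne_zero_complex))
      (Polynomial.X_add_C_ne_zero _)
  · exact one_ne_zero

lemma natDegree_stepPoly (M n : ℤ) (v : ℂ) :
    (stepPoly M n v).natDegree = if M < n then 1 else 0 := by
  unfold stepPoly
  split_ifs
  · rw [Polynomial.natDegree_C_mul (inv_ne_zero two_pi_ne_zero_complex),
      Polynomial.natDegree_X_add_C]
  · exact Polynomial.natDegree_one

/-- The archimedean `L`-factor of `φ_{-n,v} ⊗ φ_{-M,s}`. -/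
noncomputable def archFactor (M n : ℤ) (v s : ℂ) : ℂ :=
  4 * (2 * (Real.pi : ℂ)) ^ (-(2 * (s + v)) + ((min n M : ℤ) : ℂ)) *
    Complex.Gamma (s + v) * Complex.Gamma (s + v - ((min n M : ℤ) : ℂ))

lemma archFactor_ne_zero {M n : ℤ} {v s : ℂ} (hM : 0 ≤ M) (hs : (M : ℝ) < (s + v).re) :
    archFactor M n v s ≠ 0 := by
  have hM' : (0 : ℝ) ≤ M := by exact_mod_cast hM
  have hmin : ((min n M : ℤ) : ℝ) ≤ M := by exact_mod_cast min_le_right n M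
  refine mul_ne_zero (mul_ne_zero (mul_ne_zero (by norm_num) ?_) ?_) ?_
  · exact cpow_ne_zero_iff.mpr (Or.inl two_pi_ne_zero_complex)
  · exact Complex.Gamma_ne_zero_of_re_pos (hM'.trans_lt hs)
  · refine Complex.Gamma_ne_zero_of_re_pos ?_
    rw [sub_re, intCast_re]
    linarith

lemma archFactor_eq_mul_stepPoly {M n : ℤ} {v s : ℂ} (hs : ((M + 1 : ℤ) : ℝ) < (s + v).re) :
    archFactor M n v s = archFactor (M + 1) n v s * (stepPoly M n v).eval s := by
  unfold archFactor stepPoly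
  split_ifs with hn
  · have hne : s + v - ((M + 1 : ℤ) : ℂ) ≠ 0 := by
      intro h0
      have := congrArg re h0
      rw [sub_re, intCast_re, zero_re] at this
      linarith
    have hG := Complex.Gamma_add_one _ hne
    rw [min_eq_right hn.le, min_eq_right (Int.add_one_le_of_lt hn)]
    rw [show s + v - ((M + 1 : ℤ) : ℂ) + 1 = s + v - (M : ℂ) by push_cast; ring] at hG
    rw [hG, show -(2 * (s + v)) + ((M + 1 : ℤ) : ℂ) = (-(2 * (s + v)) + (M : ℂ)) + 1 by
      push_cast; ring, cpow_add _ 1 two_pi_ne_zero_complex, cpow_one]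
    simp only [Polynomial.eval_mul, Polynomial.eval_C, Polynomial.eval_add, Polynomial.eval_X]
    have h2 := mul_inv_cancel₀ two_pi_ne_zero_complex
    push_cast
    linear_combination (-(4 * (2 * (Real.pi : ℂ)) ^ (-(2 * (s + v)) + (M : ℂ)) *
      Complex.Gamma (s + v) * Complex.Gamma (s + v - ((M : ℂ) + 1)) * (s + v - (M + 1)))) * h2
  · rw [min_eq_left (not_lt.mp hn), min_eq_left ((not_lt.mp hn).trans (Int.le_add_one le_rfl)),
      Polynomial.eval_one, mul_one]

/-- If the products of archimedean factors agree at `M` and at `M + 1`, then both families have the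
same number of parameters exceeding `M`. -/
lemma card_lt_eq_of_prod_archFactor_eq {ι : Type*} [Fintype ι] {N N' : ι → ℤ} {u u' : ι → ℂ}
    {M : ℤ} (hM : 0 ≤ M)
    (h : ∀ s, ∏ i, archFactor M (N i) (u i) s = ∏ i, archFactor M (N' i) (u' i) s)
    (h_succ : ∀ s, ∏ i, archFactor (M + 1) (N i) (u i) s =
      ∏ i, archFactor (M + 1) (N' i) (u' i) s) :
    (Finset.univ.filter fun i => M < N i).card = (Finset.univ.filter fun i => M < N' i).card := by
  have hlarge (v : ι → ℂ) : ∀ᶠ k : ℕ in Filter.atTop,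
      ∀ i, ((M + 1 : ℤ) : ℝ) < ((k : ℂ) + v i).re := by
    refine Filter.eventually_all.mpr fun i => ?_
    filter_upwards [tendsto_natCast_atTop_atTop.eventually_gt_atTop
      (((M + 1 : ℤ) : ℝ) - (v i).re)] with k hk
    rw [add_re, natCast_re]
    linarith
  obtain ⟨K, hK⟩ := Filter.eventually_atTop.mp ((hlarge u).and (hlarge u'))
  have hpoly : ∏ i, stepPoly M (N i) (u i) = ∏ i, stepPoly M (N' i) (u' i) := by
    refine Polynomial.eq_of_infinite_eval_eq _ _
      (Set.infinite_of_injective_forall_mem (f := fun k : ℕ => ((k + K : ℕ) : ℂ))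
        (fun a b hab => Nat.add_right_cancel (Nat.cast_injective hab)) fun k => ?_)
    obtain ⟨hu, hu'⟩ := hK (k + K) (Nat.le_add_left K k)
    have hs := h ((k + K : ℕ) : ℂ)
    rw [Finset.prod_congr rfl fun i _ => archFactor_eq_mul_stepPoly (hu i),
      Finset.prod_congr rfl fun i _ => archFactor_eq_mul_stepPoly (hu' i),
      Finset.prod_mul_distrib, Finset.prod_mul_distrib, ← h_succ] at hs
    rw [Set.mem_ofPred_eq, Polynomial.eval_prod, Polynomial.eval_prod]
    exact mul_left_cancel₀ (Finset.prod_ne_zero_iff.mpr fun i _ =>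
      archFactor_ne_zero (by lia) (hu i)) hs
  have hdeg := congrArg Polynomial.natDegree hpoly
  rw [Polynomial.natDegree_prod _ _ fun i _ => stepPoly_ne_zero _ _ _,
    Polynomial.natDegree_prod _ _ fun i _ => stepPoly_ne_zero _ _ _] at hdeg
  simpa only [natDegree_stepPoly, Finset.card_filter] using hdeg

theorem real_case_step3_min (q : ℕ) (hq : 1 ≤ q)
    (N N' : Fin q → ℤ) (hN : ∀ i, 1 ≤ N i) (hN' : ∀ i, 1 ≤ N' i)
    (u u' : Fin q → ℂ)
    (h : ∀ M : ℤ, 0 ≤ M → ∀ s : ℂ,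
      ∏ i : Fin q, 4 * (2 * (Real.pi : ℂ)) ^ (-(2 * (s + u i)) + ((min (N i) M : ℤ) : ℂ)) *
          Complex.Gamma (s + u i) * Complex.Gamma (s + u i - ((min (N i) M : ℤ) : ℂ))
      = ∏ i : Fin q, 4 * (2 * (Real.pi : ℂ)) ^ (-(2 * (s + u' i)) + ((min (N' i) M : ℤ) : ℂ)) *
          Complex.Gamma (s + u' i) * Complex.Gamma (s + u' i - ((min (N' i) M : ℤ) : ℂ))) :
    Finset.univ.inf' (Finset.univ_nonempty_iff.mpr (Fin.pos_iff_nonempty.mp hq)) N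
      = Finset.univ.inf' (Finset.univ_nonempty_iff.mpr (Fin.pos_iff_nonempty.mp hq)) N' := by
  have hcard (M : ℤ) (hM : 0 ≤ M) := card_lt_eq_of_prod_archFactor_eq hM (h M hM)
    (h (M + 1) (by lia))
  have hlt (M : ℤ) (hM : 0 ≤ M) : (∀ i, M < N i) ↔ ∀ i, M < N' i := by
    have hiff (n : Fin q → ℤ) : (∀ i, M < n i) ↔
        (Finset.univ.filter fun i => M < n i).card = (Finset.univ : Finset (Fin q)).card := by
      simp [-Finset.card_univ, Finset.card_filter_eq_iff]
    rw [hiff, hiff, hcard M hM]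
  have hinf (M : ℤ) (hM : 0 ≤ M) :
      M < Finset.univ.inf' (Finset.univ_nonempty_iff.mpr (Fin.pos_iff_nonempty.mp hq)) N ↔
      M < Finset.univ.inf' (Finset.univ_nonempty_iff.mpr (Fin.pos_iff_nonempty.mp hq)) N' := by
    simpa [Finset.lt_inf'_iff] using hlt M hM
  have hpos (n : Fin q → ℤ) (hn : ∀ i, 1 ≤ n i) :
      1 ≤ Finset.univ.inf' (Finset.univ_nonempty_iff.mpr (Fin.pos_iff_nonempty.mp hq)) n :=
    Finset.le_inf' _ _ fun i _ => hn i
  have hm := hpos N hN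
  have hm' := hpos N' hN'
  refine le_antisymm ?_ ?_
  · exact not_lt.mp fun hlt' => lt_irrefl _ ((hinf _ (by lia)).mp hlt')
  · exact not_lt.mp fun hlt' => lt_irrefl _ ((hinf _ (by lia)).mpr hlt')
end

section
/- (Purely principal-series local converse theorem for GL_n(ℝ) with only GL(1)-twists.) Let p ∈ ℕ, let ε, ε' : Fin p → ℕ with ε i ≤ 1 and ε' i ≤ 1 for all i, and let t, t' : Fin p → ℂ. For (ε,δ) ∈ {0,1}² write γ(ε,δ) = 2 if ε = δ = 1 and γ(ε,δ) = 0 otherwise. Assume that for every δ ∈ {0,1} and every s ∈ ℂ, ∏_{i : Fin p} π^{−(s + t i − γ(ε i, δ))/2}·Γ((s + t i − γ(ε i, δ))/2) = ∏_{i : Fin p} π^{−(s + t' i − γ(ε' i, δ))/2}·Γ((s + t' i − γ(ε' i, δ))/2). Then the multiset of pairs {(ε i, t i) : i ∈ Fin p} equals {(ε' i, t' i) : i ∈ Fin p} in Multiset (ℕ × ℂ). -/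
open Complex

/-- A product of shifted real Gamma factors determines the multiset of shifts: the quotient of the
product at `s + 2` and at `s` is, up to a constant, the polynomial `∏ i, (s + a i)`. -/
theorem map_eq_of_prod_Gammaℝ_add_eq {ι : Type*} [Fintype ι] {a b : ι → ℂ}
    (h : ∀ s : ℂ, ∏ i, Gammaℝ (s + a i) = ∏ i, Gammaℝ (s + b i)) :
    Finset.univ.val.map a = Finset.univ.val.map b := by
  have key : ∀ (c : ι → ℂ) (s : ℂ), (∀ i, 0 < (s + c i).re) →
      ∏ i, Gammaℝ (s + 2 + c i) =
        (∏ i, Gammaℝ (s + c i)) * (∏ i, (s + c i)) * ∏ _i : ι, (1 / 2 / (Real.pi : ℂ)) := by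
    intro c s hs
    rw [← Finset.prod_mul_distrib, ← Finset.prod_mul_distrib]
    refine Finset.prod_congr rfl fun i _ => ?_
    have h0 : s + c i ≠ 0 := fun h0 => by simpa [h0] using hs i
    rw [add_right_comm, Gammaℝ_add_two h0]
    ring
  obtain ⟨M, hM⟩ : ∃ M : ℕ, ∀ i, -(a i).re < M ∧ -(b i).re < M := by
    obtain ⟨R, hR⟩ := (Set.finite_range fun i => max (-(a i).re) (-(b i).re)).bddAbove
    obtain ⟨M, hM⟩ := exists_nat_gt R
    exact ⟨M, fun i => max_lt_iff.1 ((hR ⟨i, rfl⟩).trans_lt hM)⟩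
  have hpoly : (∏ i, (Polynomial.X - Polynomial.C (-a i))) =
      ∏ i, (Polynomial.X - Polynomial.C (-b i)) := by
    refine Polynomial.eq_of_infinite_eval_eq _ _ ?_
    refine (Set.infinite_range_of_injective (f := fun n : ℕ => ((M + n : ℕ) : ℂ))
      (fun m n hmn => by simpa using hmn)).mono ?_
    rintro _ ⟨n, rfl⟩
    have hn : (0 : ℝ) ≤ n := n.cast_nonneg
    have ha : ∀ i, 0 < (((M + n : ℕ) : ℂ) + a i).re := fun i => by
      have := (hM i).1
      simp; linarith
    have hb : ∀ i, 0 < (((M + n : ℕ) : ℂ) + b i).re := fun i => by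
      have := (hM i).2
      simp; linarith
    have h2 := h (((M + n : ℕ) : ℂ) + 2)
    rw [key a _ ha, key b _ hb, ← h] at h2
    have h1 : ∏ _i : ι, (1 / 2 / (Real.pi : ℂ)) ≠ 0 :=
      Finset.prod_ne_zero_iff.2 fun _ _ => by simp [Real.pi_ne_zero]
    have h3 : ∏ i, Gammaℝ (((M + n : ℕ) : ℂ) + a i) ≠ 0 :=
      Finset.prod_ne_zero_iff.2 fun i _ => Gammaℝ_ne_zero_of_re_pos (ha i)
    have h4 := mul_left_cancel₀ h3 (mul_right_cancel₀ h1 h2)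
    simpa [Polynomial.eval_prod] using h4
  have hroots : ∀ c : ι → ℂ, (∏ i, (Polynomial.X - Polynomial.C (-c i))).roots =
      Finset.univ.val.map fun i => -c i := fun c => by
    rw [← Polynomial.roots_multiset_prod_X_sub_C (Finset.univ.val.map fun i => -c i),
      Multiset.map_map]
    rfl
  have h5 := congrArg Polynomial.roots hpoly
  rw [hroots, hroots] at h5
  simpa [Multiset.map_map, Function.comp_def] using congrArg (Multiset.map fun z => -z) h5

theorem count_map_sub_gam {M : Multiset (ℕ × ℂ)} (hM : ∀ x ∈ M, x.1 ≤ 1) (δ : ℕ) (z : ℂ) :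
    (M.map fun x => x.2 - (gam x.1 δ : ℂ)).count z =
      M.count (0, z) + M.count (1, z + (gam 1 δ : ℂ)) := by
  induction M using Multiset.induction with
  | empty => simp
  | cons x M ih =>
    obtain ⟨e, w⟩ := x
    have he : e ≤ 1 := hM (e, w) (Multiset.mem_cons_self _ _)
    rw [Multiset.map_cons, Multiset.count_cons, Multiset.count_cons, Multiset.count_cons,
      ih fun x hx => hM x (Multiset.mem_cons_of_mem hx)]
    have h0 : gam 0 δ = 0 := by simp [gam]
    interval_cases e
    · simp [h0]
      ring
    · simp [eq_sub_iff_add_eq, add_assoc]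

/-- A multiset of pairs `(ε, t)` with `ε ≤ 1` is determined by the multisets of `t - γ(ε, δ)`
for `δ = 0, 1`. -/
theorem eq_of_map_sub_gam_eq {M N : Multiset (ℕ × ℂ)} (hM : ∀ x ∈ M, x.1 ≤ 1)
    (hN : ∀ x ∈ N, x.1 ≤ 1)
    (h : ∀ δ ≤ 1, (M.map fun x => x.2 - (gam x.1 δ : ℂ)) = N.map fun x => x.2 - (gam x.1 δ : ℂ)) :
    M = N := by
  have hcount : ∀ δ ≤ 1, ∀ z, M.count (0, z) + M.count (1, z + (gam 1 δ : ℂ)) =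
      N.count (0, z) + N.count (1, z + (gam 1 δ : ℂ)) := fun δ hδ z => by
    rw [← count_map_sub_gam hM, ← count_map_sub_gam hN, h δ hδ]
  have h0 : ∀ z, M.count (0, z) + M.count (1, z) = N.count (0, z) + N.count (1, z) := by
    simpa [gam] using hcount 0 zero_le_one
  have h1 : ∀ z, M.count (0, z) + M.count (1, z + 2) = N.count (0, z) + N.count (1, z + 2) := by
    simpa [gam] using hcount 1 le_rfl
  have hper : ∀ (z : ℂ) (n : ℕ), M.count (1, z) + N.count (1, z + 2 * n) =
      N.count (1, z) + M.count (1, z + 2 * n) := by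
    intro z n
    induction n with
    | zero => simp [add_comm]
    | succ n ih =>
      have e0 := h0 (z + 2 * n)
      have e1 := h1 (z + 2 * n)
      rw [show z + 2 * ((n + 1 : ℕ) : ℂ) = z + 2 * n + 2 by push_cast; ring]
      lia
  have hone : ∀ z, M.count (1, z) = N.count (1, z) := by
    intro z
    have hinj : Function.Injective fun n : ℕ => ((1 : ℕ), z + 2 * (n : ℂ)) := fun m n hmn => by
      simpa using hmn
    obtain ⟨_, ⟨n, rfl⟩, hn⟩ :=
      (Set.infinite_range_of_injective hinj).exists_notMem_finset (M + N).toFinset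
    simp only [Multiset.mem_toFinset, Multiset.mem_add, not_or] at hn
    simpa [Multiset.count_eq_zero_of_notMem hn.1, Multiset.count_eq_zero_of_notMem hn.2]
      using hper z n
  ext ⟨e, z⟩
  rcases Nat.lt_or_ge 1 e with he | he
  · rw [Multiset.count_eq_zero_of_notMem fun hx => (hM _ hx).not_gt he,
      Multiset.count_eq_zero_of_notMem fun hx => (hN _ hx).not_gt he]
  · have e0 := h0 z
    have e1 := hone z
    interval_cases e <;> lia

theorem principal_series_local_converse_real (p : ℕ) (ε ε' : Fin p → ℕ)
    (hε : ∀ i, ε i ≤ 1) (hε' : ∀ i, ε' i ≤ 1) (t t' : Fin p → ℂ)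
    (h : ∀ δ : ℕ, δ ≤ 1 → ∀ s : ℂ,
      ∏ i : Fin p, (Real.pi : ℂ) ^ (-((s + t i - (gam (ε i) δ : ℂ)) / 2)) *
          Complex.Gamma ((s + t i - (gam (ε i) δ : ℂ)) / 2)
      = ∏ i : Fin p, (Real.pi : ℂ) ^ (-((s + t' i - (gam (ε' i) δ : ℂ)) / 2)) *
          Complex.Gamma ((s + t' i - (gam (ε' i) δ : ℂ)) / 2)) :
    Finset.univ.val.map (fun i => (ε i, t i)) = Finset.univ.val.map (fun i => (ε' i, t' i)) := by
  refine eq_of_map_sub_gam_eq (by simpa using hε) (by simpa using hε') fun δ hδ => ?_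
  rw [Multiset.map_map, Multiset.map_map]
  refine map_eq_of_prod_Gammaℝ_add_eq fun s => ?_
  simpa only [Gammaℝ_def, Function.comp_apply, neg_div, add_sub_assoc] using h δ hδ s
end

section
/- (GL(2)-twists alone determine the shape of a real parameter.) Let p, q, p', q' ∈ ℕ, let ε : Fin p → ℕ and ε' : Fin p' → ℕ with ε i ≤ 1 and ε' j ≤ 1 for all i, j, let t : Fin p → ℂ, t' : Fin p' → ℂ, let N : Fin q → ℤ, N' : Fin q' → ℤ with N i ≥ 1 and N' j ≥ 1 for all i, j, and let u : Fin q → ℂ, u' : Fin q' → ℂ. Assume that for every integer M ≥ 0 and every s ∈ ℂ, ∏_{i : Fin p} 2·(2π)^{−(s + t i − ε i)}·Γ(s + t i − ε i) · ∏_{i : Fin q} 4·(2π)^{−2(s + u i) + min(N i, M)}·Γ(s + u i)·Γ(s + u i − min(N i, M)) equals the same expression with (p', ε', t', q', N', u') in place of (p, ε, t, q, N, u). Then p = p', q = q', the multiset {t i − ε i : i ∈ Fin p} equals {t' j − ε' j : j ∈ Fin p'}, and the multiset {u i : i ∈ Fin q} equals {u' j : j ∈ Fin q'} (in Multiset ℂ).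 -/
open Complex

/-- The order of vanishing of `s ↦ 1 / Γ(s + a)` at `z`. -/
noncomputable def invGammaOrder (a z : ℂ) : ℕ :=
  analyticOrderNatAt (fun s => (Complex.Gamma (s + a))⁻¹) z

lemma analyticAt_inv_Gamma_add (a z : ℂ) :
    AnalyticAt ℂ (fun s => (Complex.Gamma (s + a))⁻¹) z :=
  (Complex.differentiable_one_div_Gamma.comp (differentiable_id.add_const a)).analyticAt z

lemma analyticOrderAt_inv_Gamma_add_ne_top (a z : ℂ) :
    analyticOrderAt (fun s => (Complex.Gamma (s + a))⁻¹) z ≠ ⊤ := by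
  intro htop
  have heq : (fun s => (Complex.Gamma (s + a))⁻¹) = 0 :=
    AnalyticOnNhd.eq_of_eventuallyEq (fun w _ => analyticAt_inv_Gamma_add a w)
      (fun w _ => analyticAt_const) (analyticOrderAt_eq_top.mp htop)
  simpa using congrFun heq (1 - a)

lemma coe_invGammaOrder (a z : ℂ) :
    (invGammaOrder a z : ℕ∞) = analyticOrderAt (fun s => (Complex.Gamma (s + a))⁻¹) z :=
  ENat.natCast_toNat (analyticOrderAt_inv_Gamma_add_ne_top a z)

lemma analyticOrderAt_add_const (a z : ℂ) :
    analyticOrderAt (fun s => s + a) z = if z = -a then 1 else 0 := by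
  have hf : AnalyticAt ℂ (fun s : ℂ => s + a) z := by fun_prop
  split_ifs with hz
  · rw [show (1 : ℕ∞) = ((1 : ℕ) : ℕ∞) from rfl, hf.analyticOrderAt_eq_natCast]
    refine ⟨fun _ => 1, analyticAt_const, one_ne_zero, Filter.Eventually.of_forall fun s => ?_⟩
    simp [hz]
  · rw [hf.analyticOrderAt_eq_zero]
    exact fun h0 => hz (eq_neg_of_add_eq_zero_left h0)

lemma invGammaOrder_eq (a z : ℂ) :
    invGammaOrder a z = (if z = -a then 1 else 0) + invGammaOrder a (z + 1) := by
  have hrec : (fun s => (Complex.Gamma (s + a))⁻¹) =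
      (fun s => s + a) * fun s => (Complex.Gamma (s + (a + 1)))⁻¹ := by
    funext s
    simpa [add_assoc] using Complex.one_div_Gamma_eq_self_mul_one_div_Gamma_add_one (s + a)
  have hshift : analyticOrderAt (fun s => (Complex.Gamma (s + (a + 1)))⁻¹) z =
      analyticOrderAt (fun s => (Complex.Gamma (s + a))⁻¹) (z + 1) := by
    have hcomp : (fun s => (Complex.Gamma (s + (a + 1)))⁻¹) =
        (fun s => (Complex.Gamma (s + a))⁻¹) ∘ fun s => s + 1 := by
      funext s
      simp [add_assoc, add_comm a 1]
    rw [hcomp]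
    exact analyticOrderAt_comp_of_deriv_ne_zero (by fun_prop) (by simp)
  have hcoe : (invGammaOrder a z : ℕ∞) =
      (((if z = -a then 1 else 0) + invGammaOrder a (z + 1) : ℕ) : ℕ∞) := by
    push_cast
    rw [coe_invGammaOrder, coe_invGammaOrder, hrec,
      analyticOrderAt_mul (by fun_prop) (analyticAt_inv_Gamma_add _ _),
      analyticOrderAt_add_const, ← hrec, hshift]
  exact_mod_cast hcoe

lemma analyticOrderAt_prod_inv_Gamma (S : Multiset ℂ) (z : ℂ) :
    AnalyticAt ℂ (fun s => (S.map fun a => (Complex.Gamma (s + a))⁻¹).prod) z ∧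
      analyticOrderAt (fun s => (S.map fun a => (Complex.Gamma (s + a))⁻¹).prod) z =
        ((S.map fun a => invGammaOrder a z).sum : ℕ) := by
  induction S using Multiset.induction with
  | empty =>
    refine ⟨by simpa using analyticAt_const, ?_⟩
    simp [analyticAt_const.analyticOrderAt_eq_zero]
  | cons b S ih =>
    have hcons : (fun s => ((b ::ₘ S).map fun a => (Complex.Gamma (s + a))⁻¹).prod) =
        (fun s => (Complex.Gamma (s + b))⁻¹) *
          fun s => (S.map fun a => (Complex.Gamma (s + a))⁻¹).prod := by
      funext s
      simp
    rw [hcons]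
    refine ⟨(analyticAt_inv_Gamma_add b z).mul ih.1, ?_⟩
    rw [analyticOrderAt_mul (analyticAt_inv_Gamma_add b z) ih.1, ih.2, ← coe_invGammaOrder]
    simp

lemma sum_invGammaOrder_eq_count (S : Multiset ℂ) (b : ℂ) :
    (S.map fun a => invGammaOrder a (-b)).sum =
      S.count b + (S.map fun a => invGammaOrder a (-b + 1)).sum := by
  induction S using Multiset.induction with
  | empty => simp
  | cons a S ih =>
    rw [Multiset.map_cons, Multiset.sum_cons, ih, invGammaOrder_eq, Multiset.map_cons,
      Multiset.sum_cons, Multiset.count_cons]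
    simp only [neg_inj]
    ring

/-- A product of shifted Gamma functions determines the multiset of shifts, up to a nowhere
vanishing entire factor. -/
lemma multiset_eq_of_prod_Gamma_eq {S T : Multiset ℂ} {K L : ℂ → ℂ}
    (hK : Differentiable ℂ K) (hL : Differentiable ℂ L)
    (hK0 : ∀ s, K s ≠ 0) (hL0 : ∀ s, L s ≠ 0)
    (h : ∀ s, K s * (S.map fun a => Complex.Gamma (s + a)).prod =
      L s * (T.map fun a => Complex.Gamma (s + a)).prod) : S = T := by
  have hinv : (L * fun s => (S.map fun a => (Complex.Gamma (s + a))⁻¹).prod) =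
      K * fun s => (T.map fun a => (Complex.Gamma (s + a))⁻¹).prod := by
    funext s
    have hs := congrArg (·⁻¹) (h s)
    simp only [mul_inv, ← Multiset.prod_map_inv'] at hs
    simp only [Multiset.map_map, Function.comp_def] at hs
    have hKs := hK0 s
    have hLs := hL0 s
    simp only [Pi.mul_apply]
    generalize (S.map fun a => (Complex.Gamma (s + a))⁻¹).prod = x at hs ⊢
    generalize (T.map fun a => (Complex.Gamma (s + a))⁻¹).prod = y at hs ⊢
    field_simp at hs
    linear_combination hs
  have hord (z : ℂ) : (S.map fun a => invGammaOrder a z).sum =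
      (T.map fun a => invGammaOrder a z).sum := by
    have hz := congrArg (analyticOrderAt · z) hinv
    rw [analyticOrderAt_mul (hL.analyticAt z) (analyticOrderAt_prod_inv_Gamma S z).1,
      analyticOrderAt_mul (hK.analyticAt z) (analyticOrderAt_prod_inv_Gamma T z).1,
      (analyticOrderAt_prod_inv_Gamma S z).2, (analyticOrderAt_prod_inv_Gamma T z).2,
      (hL.analyticAt z).analyticOrderAt_eq_zero.mpr (hL0 z),
      (hK.analyticAt z).analyticOrderAt_eq_zero.mpr (hK0 z), zero_add, zero_add] at hz
    exact_mod_cast hz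
  ext b
  have hS := sum_invGammaOrder_eq_count S b
  have hT := sum_invGammaOrder_eq_count T b
  have h0 := hord (-b)
  have h1 := hord (-b + 1)
  omega

/-- The product of the twisted L-factors is a nowhere vanishing entire function times a product
of shifted Gamma functions. -/
lemma exists_factor_prod_Gamma {p q : ℕ} (ε : Fin p → ℕ) (t : Fin p → ℂ) (n : Fin q → ℤ)
    (u : Fin q → ℂ) :
    ∃ K : ℂ → ℂ, Differentiable ℂ K ∧ (∀ s, K s ≠ 0) ∧ ∀ s : ℂ,
      (∏ i : Fin p, 2 * (2 * (Real.pi : ℂ)) ^ (-(s + t i - (ε i : ℂ))) *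
          Complex.Gamma (s + t i - (ε i : ℂ))) *
        ∏ i : Fin q, 4 * (2 * (Real.pi : ℂ)) ^ (-(2 * (s + u i)) + ((n i : ℤ) : ℂ)) *
          Complex.Gamma (s + u i) * Complex.Gamma (s + u i - ((n i : ℤ) : ℂ)) =
      K s * ((Finset.univ.val.map (fun i => t i - (ε i : ℂ)) + Finset.univ.val.map u +
        Finset.univ.val.map (fun i => u i - (n i : ℂ))).map
          fun a => Complex.Gamma (s + a)).prod := by
  have hpi : (2 * (Real.pi : ℂ)) ≠ 0 := by simp [Real.pi_ne_zero]
  refine ⟨fun s => (∏ i : Fin p, 2 * (2 * (Real.pi : ℂ)) ^ (-(s + t i - (ε i : ℂ)))) *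
    ∏ i : Fin q, 4 * (2 * (Real.pi : ℂ)) ^ (-(2 * (s + u i)) + ((n i : ℤ) : ℂ)), ?_, ?_, ?_⟩
  · refine Differentiable.mul ?_ ?_
    · refine Differentiable.fun_finsetProd fun i _ => ?_
      exact (Differentiable.const_cpow (by fun_prop) (Or.inl hpi)).const_mul _
    · refine Differentiable.fun_finsetProd fun i _ => ?_
      exact (Differentiable.const_cpow (by fun_prop) (Or.inl hpi)).const_mul _
  · intro s
    refine mul_ne_zero (Finset.prod_ne_zero_iff.mpr fun i _ => ?_)
      (Finset.prod_ne_zero_iff.mpr fun i _ => ?_)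
    · exact mul_ne_zero two_ne_zero (by simp [Complex.cpow_eq_zero_iff, Real.pi_ne_zero])
    · exact mul_ne_zero (by norm_num) (by simp [Complex.cpow_eq_zero_iff, Real.pi_ne_zero])
  · intro s
    simp only [Multiset.map_add, Multiset.prod_add, Multiset.map_map, Function.comp_def,
      Finset.prod_map_val, Finset.prod_mul_distrib, add_sub_assoc]
    ring

/-- Two finite multisets whose difference is invariant under translation by `1` are equal. -/
lemma multiset_eq_of_add_map_sub_one {U V : Multiset ℂ}
    (h : U + V.map (fun z => z - 1) = V + U.map (fun z => z - 1)) : U = V := by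
  have hshift (W : Multiset ℂ) (z : ℂ) : (W.map fun z => z - 1).count z = W.count (z + 1) := by
    simpa using Multiset.count_map_eq_count' (fun z : ℂ => z - 1) W sub_left_injective (z + 1)
  have hstep (z : ℂ) : U.count z + V.count (z + 1) = V.count z + U.count (z + 1) := by
    simpa [hshift] using congrArg (Multiset.count z) h
  have hiter (z : ℂ) (n : ℕ) : U.count z + V.count (z + n) = V.count z + U.count (z + n) := by
    induction n with
    | zero => simp [add_comm]
    | succ n ih =>
      have hn := hstep (z + n)
      rw [add_assoc] at hn
      push_cast
      omega
  ext z
  have hinj : Function.Injective fun n : ℕ => z + n :=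
    (add_right_injective z).comp Nat.cast_injective
  obtain ⟨_, ⟨n, rfl⟩, hn⟩ :=
    (Set.infinite_range_of_injective hinj).exists_notMem_finset (U + V).toFinset
  simp only [Multiset.mem_toFinset, Multiset.mem_add, not_or] at hn
  simpa [Multiset.count_eq_zero_of_notMem hn.1, Multiset.count_eq_zero_of_notMem hn.2]
    using hiter z n

theorem GL2_twists_determine_shape
    (p q p' q' : ℕ)
    (ε : Fin p → ℕ) (ε' : Fin p' → ℕ)
    (hε : ∀ i, ε i ≤ 1) (hε' : ∀ j, ε' j ≤ 1)
    (t : Fin p → ℂ) (t' : Fin p' → ℂ)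
    (N : Fin q → ℤ) (N' : Fin q' → ℤ)
    (hN : ∀ i, 1 ≤ N i) (hN' : ∀ j, 1 ≤ N' j)
    (u : Fin q → ℂ) (u' : Fin q' → ℂ)
    (h : ∀ M : ℤ, 0 ≤ M → ∀ s : ℂ,
      (∏ i : Fin p, 2 * (2 * (Real.pi : ℂ)) ^ (-(s + t i - (ε i : ℂ))) *
          Complex.Gamma (s + t i - (ε i : ℂ))) *
        ∏ i : Fin q, 4 * (2 * (Real.pi : ℂ)) ^ (-(2 * (s + u i)) + ((min (N i) M : ℤ) : ℂ)) *
          Complex.Gamma (s + u i) * Complex.Gamma (s + u i - ((min (N i) M : ℤ) : ℂ))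
      = (∏ j : Fin p', 2 * (2 * (Real.pi : ℂ)) ^ (-(s + t' j - (ε' j : ℂ))) *
          Complex.Gamma (s + t' j - (ε' j : ℂ))) *
        ∏ j : Fin q', 4 * (2 * (Real.pi : ℂ)) ^ (-(2 * (s + u' j)) + ((min (N' j) M : ℤ) : ℂ)) *
          Complex.Gamma (s + u' j) * Complex.Gamma (s + u' j - ((min (N' j) M : ℤ) : ℂ))) :
    p = p' ∧ q = q' ∧
      Finset.univ.val.map (fun i => t i - (ε i : ℂ))
        = Finset.univ.val.map (fun j => t' j - (ε' j : ℂ)) ∧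
      Finset.univ.val.map u = Finset.univ.val.map u' := by
  have hmult (M : ℤ) (hM : 0 ≤ M) :
      Finset.univ.val.map (fun i => t i - (ε i : ℂ)) + Finset.univ.val.map u +
        Finset.univ.val.map (fun i => u i - ((min (N i) M : ℤ) : ℂ)) =
      Finset.univ.val.map (fun j => t' j - (ε' j : ℂ)) + Finset.univ.val.map u' +
        Finset.univ.val.map (fun j => u' j - ((min (N' j) M : ℤ) : ℂ)) := by
    obtain ⟨K, hK, hK0, hKs⟩ := exists_factor_prod_Gamma ε t (fun i => min (N i) M) u
    obtain ⟨L, hL, hL0, hLs⟩ := exists_factor_prod_Gamma ε' t' (fun j => min (N' j) M) u'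
    exact multiset_eq_of_prod_Gamma_eq hK hL hK0 hL0 fun s => by rw [← hKs, ← hLs, h M hM s]
  have h0 := hmult 0 le_rfl
  have h1 := hmult 1 zero_le_one
  have hmin0 (i) : min (N i) 0 = 0 := min_eq_right (zero_le_one.trans (hN i))
  have hmin0' (j) : min (N' j) 0 = 0 := min_eq_right (zero_le_one.trans (hN' j))
  have hmin1 (i) : min (N i) 1 = 1 := min_eq_right (hN i)
  have hmin1' (j) : min (N' j) 1 = 1 := min_eq_right (hN' j)
  simp only [hmin0, hmin0', Int.cast_zero, sub_zero] at h0
  change _ + _ + Finset.univ.val.map u = _ + _ + Finset.univ.val.map u' at h0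
  simp only [hmin1, hmin1', Int.cast_one] at h1
  rw [show Finset.univ.val.map (fun i => u i - 1) =
      (Finset.univ.val.map u).map (fun z => z - 1) by rw [Multiset.map_map]; rfl,
    show Finset.univ.val.map (fun j => u' j - 1) =
      (Finset.univ.val.map u').map (fun z => z - 1) by rw [Multiset.map_map]; rfl] at h1
  have hu : Finset.univ.val.map u = Finset.univ.val.map u' := by
    apply multiset_eq_of_add_map_sub_one
    ext z
    have c0 := congrArg (Multiset.count z) h0
    have c1 := congrArg (Multiset.count z) h1
    simp only [Multiset.count_add] at c0 c1 ⊢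
    omega
  have ht : Finset.univ.val.map (fun i => t i - (ε i : ℂ)) =
      Finset.univ.val.map (fun j => t' j - (ε' j : ℂ)) := by
    rw [hu] at h0
    exact add_right_cancel (add_right_cancel h0)
  exact ⟨by simpa using congrArg Multiset.card ht, by simpa using congrArg Multiset.card hu, ht, hu⟩
end

section
/- (GL_3(ℝ), the case of parameters with a 2-dimensional constituent: multiset identities force equality.) Let ε, ε' ∈ ℕ with ε ≤ 1 and ε' ≤ 1, and let t, t', u, u' ∈ ℂ. For each δ ∈ {0,1} write γ(ε,δ) = 2 if ε = δ = 1 and γ(ε,δ) = 0 otherwise. If for each δ ∈ {0,1} the multiset {t − δ, t + 1 − δ, u − γ(ε,δ)} equals the multiset {t' − δ, t' + 1 − δ, u' − γ(ε',δ)} (in Multiset ℂ), then t = t', u = u' and ε = ε'. -/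
theorem GL3_real_two_dim_case_multisets (ε ε' : ℕ) (hε : ε ≤ 1) (hε' : ε' ≤ 1)
    (t t' u u' : ℂ)
    (h : ∀ δ : ℕ, δ ≤ 1 →
      ({t - (δ : ℂ), t + 1 - (δ : ℂ), u - (gam ε δ : ℂ)} : Multiset ℂ)
        = ({t' - (δ : ℂ), t' + 1 - (δ : ℂ), u' - (gam ε' δ : ℂ)} : Multiset ℂ)) :
    t = t' ∧ u = u' ∧ ε = ε' := by
  have sum_eq (δ : ℕ) (hδ : δ ≤ 1) := congrArg Multiset.sum (h δ hδ)
  have sum_sq_eq (δ : ℕ) (hδ : δ ≤ 1) :=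
    congrArg (fun s : Multiset ℂ => (s.map (· ^ 2)).sum) (h δ hδ)
  have s₀ := sum_eq 0 zero_le_one
  have s₁ := sum_eq 1 le_rfl
  have q₀ := sum_sq_eq 0 zero_le_one
  have q₁ := sum_sq_eq 1 le_rfl
  simp only [Multiset.insert_eq_cons, Multiset.map_cons, Multiset.map_singleton,
    Multiset.sum_cons, Multiset.sum_singleton] at s₀ s₁ q₀ q₁
  have hεε' : ε = ε' := by
    interval_cases ε <;> interval_cases ε' <;> simp [gam] at s₀ s₁ ⊢ <;> grind
  subst hεε'
  have ht : t = t' := by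
    interval_cases ε <;> simp [gam] at s₀ q₀ q₁ <;> grind
  subst ht
  refine ⟨rfl, ?_, rfl⟩
  simpa [gam] using s₀
end

section
/- (GL_2(ℝ) proposition, case of two irreducible 2-dimensional parameters.) Let N, N' ∈ ℤ with N ≥ 1 and N' ≥ 1 and let t, t' ∈ ℂ. Assume: (central character equality) 2t − N = 2t' − N' and N ≡ N' (mod 2); and (L-factor equality) for every δ ∈ {0,1} and every s ∈ ℂ, 2·(2π)^{−(s + t − δ)}·Γ(s + t − δ) = 2·(2π)^{−(s + t' − δ)}·Γ(s + t' − δ). Then N = N' and t = t'. -/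
open Complex

/-- If the `L`-factors attached to `a` and `b` agree, then every shift sending `a` to the pole
`0` of `Γ` sends `b` to a pole of `Γ`. -/
theorem exists_sub_eq_neg_nat_of_LFactor_eq {a b : ℂ}
    (h : ∀ s : ℂ, 2 * (2 * (Real.pi : ℂ)) ^ (-(s + a)) * Complex.Gamma (s + a)
      = 2 * (2 * (Real.pi : ℂ)) ^ (-(s + b)) * Complex.Gamma (s + b)) :
    ∃ m : ℕ, b - a = -(m : ℂ) := by
  have hpi : (2 * (Real.pi : ℂ)) ≠ 0 := by simp [Real.pi_ne_zero]
  have h0 := h (-a)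
  rw [neg_add_cancel, Complex.Gamma_zero, mul_zero, eq_comm, mul_eq_zero] at h0
  have hG : Complex.Gamma (-a + b) = 0 :=
    h0.resolve_left (mul_ne_zero two_ne_zero (by simp [Complex.cpow_eq_zero_iff, hpi]))
  obtain ⟨m, hm⟩ := (Complex.Gamma_eq_zero_iff _).1 hG
  exact ⟨m, by rw [← hm]; ring⟩

theorem GL2_real_two_dim_case (N N' : ℤ) (hN : 1 ≤ N) (hN' : 1 ≤ N') (t t' : ℂ)
    (hcc1 : 2 * t - (N : ℂ) = 2 * t' - (N' : ℂ))
    (hcc2 : N ≡ N' [ZMOD 2])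
    (hL : ∀ δ : ℕ, δ ≤ 1 → ∀ s : ℂ,
      2 * (2 * (Real.pi : ℂ)) ^ (-(s + t - (δ : ℂ))) * Complex.Gamma (s + t - (δ : ℂ))
      = 2 * (2 * (Real.pi : ℂ)) ^ (-(s + t' - (δ : ℂ))) * Complex.Gamma (s + t' - (δ : ℂ))) :
    N = N' ∧ t = t' := by
  have h0 := hL 0 zero_le_one
  simp only [Nat.cast_zero, sub_zero] at h0
  obtain ⟨m, hm⟩ := exists_sub_eq_neg_nat_of_LFactor_eq h0
  obtain ⟨n, hn⟩ := exists_sub_eq_neg_nat_of_LFactor_eq fun s => (h0 s).symm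
  have hmn : ((m + n : ℕ) : ℂ) = 0 := by
    push_cast
    linear_combination hm + hn
  have hm0 : m = 0 := by
    have : m + n = 0 := by exact_mod_cast hmn
    omega
  subst hm0
  have ht : t = t' := by
    rw [Nat.cast_zero, neg_zero] at hm
    exact (sub_eq_zero.1 hm).symm
  subst ht
  exact ⟨by exact_mod_cast sub_right_injective hcc1, rfl⟩
end
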